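/- arXiv:1112.4310 — 3 statements merged into one kernel-verified Lean document; each statement's English description precedes it below -/
import Mathlib

section
/- Let N ≥ 3 and let S = I_{11} ∪ I_{22} ∪ ⋯ ∪ I_{NN} be the union of the diagonal blocks of an R×C table. Then the set of all moves of Types I, II, III and IV belonging to M_S forms a Markov basis for the configuration A_S. -/
open Finset

namespace Paper

abbrev Table (R C : ℕ) := Fin R × Fin C → ℤ

/-- The table with entry 1 in cell `a` and 0 elsewhere. -/
def e {R C : ℕ} (a : Fin R × Fin C) : Table R C := fun p => if p = a then 1 else 0

/-- The l1-norm of an integer table. -/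
def l1 {R C : ℕ} (z : Table R C) : ℤ := ∑ p : Fin R × Fin C, |z p|

/-- The configuration `A_{S_1,…,S_N}` : row sums, column sums and subtable sums. -/
def configMap {R C N : ℕ} (S : Fin N → Finset (Fin R × Fin C)) (z : Table R C) :
    (Fin R → ℤ) × (Fin C → ℤ) × (Fin N → ℤ) :=
  ⟨fun i => ∑ j, z (i, j), fun j => ∑ i, z (i, j), fun n => ∑ p ∈ S n, z p⟩

/-- A move for `A_{S_1,…,S_N}` : an integer table with vanishing row sums,
column sums and subtable sums. -/
def IsMove {R C N : ℕ} (S : Fin N → Finset (Fin R × Fin C)) (z : Table R C) : Prop :=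
  configMap S z = 0

/-- The fiber `F_t` of the configuration `A_{S_1,…,S_N}` : nonnegative integer tables
with prescribed row sums, column sums and subtable sums. -/
def Fiber {R C N : ℕ} (S : Fin N → Finset (Fin R × Fin C))
    (t : (Fin R → ℤ) × (Fin C → ℤ) × (Fin N → ℤ)) : Set (Table R C) :=
  {x | (∀ p, 0 ≤ x p) ∧ configMap S x = t}

/-- `B` is a Markov basis for the configuration `A_{S_1,…,S_N}`. -/
def IsMarkovBasis {R C N : ℕ} (S : Fin N → Finset (Fin R × Fin C))
    (B : Set (Table R C)) : Prop :=
  B.Finite ∧ (∀ z ∈ B, IsMove S z) ∧ (∀ z ∈ B, -z ∈ B) ∧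
    ∀ t, ∀ x ∈ Fiber S t, ∀ y ∈ Fiber S t, x ≠ y →
      ∃ U : ℕ, 0 < U ∧ ∃ zs : Fin U → Table R C,
        (∀ u, zs u ∈ B) ∧ y = x + ∑ u, zs u ∧
        ∀ u : Fin U, (x + ∑ s ∈ Finset.Iic u, zs s) ∈ Fiber S t

/-- `‖x − y‖₁` can be reduced by the set of moves `B` within the fiber `F`. -/
def CanReduce {R C : ℕ} (F : Set (Table R C)) (B : Set (Table R C))
    (x y : Table R C) : Prop :=
  ∃ τp τm : ℕ, 0 < τp + τm ∧
    ∃ (Bp : Fin τp → Table R C) (Bm : Fin τm → Table R C),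
      (∀ s, Bp s ∈ B) ∧ (∀ s, Bm s ∈ B) ∧
      (∀ u : Fin τp, (x + ∑ s ∈ Finset.Iic u, Bp s) ∈ F) ∧
      (∀ u : Fin τm, (y - ∑ s ∈ Finset.Iic u, Bm s) ∈ F) ∧
      l1 (x - y + ∑ s, Bp s + ∑ s, Bm s) < l1 (x - y)

/-- Basic moves (moves of Type I). -/
def IsBasicMove {R C : ℕ} (z : Table R C) : Prop :=
  ∃ (i i' : Fin R) (j j' : Fin C), i ≠ i' ∧ j ≠ j' ∧
    z = e (i, j) + e (i', j') - e (i', j) - e (i, j')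

/-- A rectangle in the set of cells. -/
def IsRectangle {R C : ℕ} (S : Finset (Fin R × Fin C)) : Prop :=
  ∃ (a₁ a₂ : Fin R) (b₁ b₂ : Fin C), a₁ < a₂ ∧ b₁ < b₂ ∧
    S = Finset.univ.filter fun p => a₁ ≤ p.1 ∧ p.1 ≤ a₂ ∧ b₁ ≤ p.2 ∧ p.2 ≤ b₂

/-- The positive part `z⁺` of a move. -/
def posPart {R C : ℕ} (z : Table R C) : Table R C := fun p => max (z p) 0

/-- The negative part `z⁻` of a move. -/
def negPart {R C : ℕ} (z : Table R C) : Table R C := fun p => max (-z p) 0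

/-- The `(k,l)` block `I_{kl}` (cells are 1-indexed in the paper, hence the `+ 1`). -/
def block {R C : ℕ} (rr cc : ℕ → ℕ) (k l : ℕ) : Finset (Fin R × Fin C) :=
  Finset.univ.filter fun p =>
    rr k ≤ p.1.1 + 1 ∧ p.1.1 + 1 < rr (k+1) ∧ cc l ≤ p.2.1 + 1 ∧ p.2.1 + 1 < cc (l+1)

/-- `S = I_{11} ∪ I_{22} ∪ ⋯ ∪ I_{NN}` : the union of the diagonal blocks. -/
def Sdiag {R C : ℕ} (N : ℕ) (rr cc : ℕ → ℕ) : Finset (Fin R × Fin C) :=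
  (Finset.Icc 1 N).biUnion fun k => block rr cc k k

/-- Two cells lie in a common block `I_{kl}` with `1 ≤ k,l ≤ Nb`. -/
def SameBlock {R C : ℕ} (Nb : ℕ) (rr cc : ℕ → ℕ) (p q : Fin R × Fin C) : Prop :=
  ∃ k l, 1 ≤ k ∧ k ≤ Nb ∧ 1 ≤ l ∧ l ≤ Nb ∧
    p ∈ block (R := R) (C := C) rr cc k l ∧ q ∈ block rr cc k l

/-- Two row indices lie in a common row block `[r_k, r_{k+1})`. -/
def SameRowBlock {R : ℕ} (Nb : ℕ) (rr : ℕ → ℕ) (i i' : Fin R) : Prop :=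
  ∃ k, 1 ≤ k ∧ k ≤ Nb ∧ rr k ≤ i.1 + 1 ∧ i.1 + 1 < rr (k+1) ∧
    rr k ≤ i'.1 + 1 ∧ i'.1 + 1 < rr (k+1)

/-- Moves of Type II: a degree-3 square-free move whose six nonzero cells
lie outside `S` and in six pairwise distinct blocks.  `Nd` bounds the index of the
diagonal blocks of `S`, `Nb` bounds the block indices. -/
def IsTypeII {R C : ℕ} (Nd Nb : ℕ) (rr cc : ℕ → ℕ) (z : Table R C) : Prop :=
  ∃ (i₁ i₂ i₃ : Fin R) (j₁ j₂ j₃ : Fin C),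
    z = e (i₁,j₂) + e (i₂,j₃) + e (i₃,j₁) - e (i₁,j₃) - e (i₂,j₁) - e (i₃,j₂) ∧
    (∀ p ∈ ([(i₁,j₂),(i₂,j₃),(i₃,j₁),(i₁,j₃),(i₂,j₁),(i₃,j₂)] : List (Fin R × Fin C)),
      p ∉ Sdiag Nd rr cc) ∧
    List.Pairwise (fun p q => ¬ SameBlock Nb rr cc p q)
      [(i₁,j₂),(i₂,j₃),(i₃,j₁),(i₁,j₃),(i₂,j₁),(i₃,j₂)]

/-- Moves of Type III. -/
def IsTypeIII {R C : ℕ} (Nd Nb : ℕ) (rr cc : ℕ → ℕ) (z : Table R C) : Prop :=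
  ∃ (i₁ i₂ i₃ : Fin R) (j₁ j₂ j₃ : Fin C),
    z = e (i₁,j₁) + e (i₂,j₃) + e (i₃,j₂) - e (i₁,j₃) - e (i₂,j₂) - e (i₃,j₁) ∧
    (∃ k l, 1 ≤ k ∧ k ≤ Nd ∧ 1 ≤ l ∧ l ≤ Nd ∧ k ≠ l ∧
      (i₁,j₁) ∈ block (R := R) (C := C) rr cc k k ∧ (i₂,j₂) ∈ block rr cc l l) ∧
    (∀ p ∈ ([(i₂,j₃),(i₃,j₂),(i₁,j₃),(i₃,j₁)] : List (Fin R × Fin C)),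
      p ∉ Sdiag Nd rr cc) ∧
    List.Pairwise (fun p q => ¬ SameBlock Nb rr cc p q) [(i₂,j₃),(i₃,j₂),(i₁,j₃),(i₃,j₁)]

/-- Moves of Type IV (row version). -/
def IsTypeIVrow {R C : ℕ} (Nd Nb : ℕ) (rr cc : ℕ → ℕ) (z : Table R C) : Prop :=
  ∃ (i₁ i₂ i₃ i₄ : Fin R) (j₁ j₂ j₃ j₄ : Fin C),
    z = e (i₁,j₁) + e (i₂,j₂) + e (i₃,j₃) + e (i₄,j₄)
        - e (i₁,j₃) - e (i₂,j₄) - e (i₃,j₂) - e (i₄,j₁) ∧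
    (∃ k l, 1 ≤ k ∧ k ≤ Nd ∧ 1 ≤ l ∧ l ≤ Nd ∧ k ≠ l ∧
      (i₁,j₁) ∈ block (R := R) (C := C) rr cc k k ∧ (i₃,j₂) ∈ block rr cc l l) ∧
    (∀ p ∈ ([(i₂,j₂),(i₃,j₃),(i₄,j₄),(i₁,j₃),(i₂,j₄),(i₄,j₁)] : List (Fin R × Fin C)),
      p ∉ Sdiag Nd rr cc) ∧
    SameRowBlock Nb rr i₁ i₂ ∧ SameRowBlock Nb rr i₃ i₄

/-- Moves of Type IV, including the transposes of the row-version moves. -/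
def IsTypeIV {R C : ℕ} (Nd Nb : ℕ) (rr cc : ℕ → ℕ) (z : Table R C) : Prop :=
  IsTypeIVrow Nd Nb rr cc z ∨
    IsTypeIVrow (R := C) (C := R) Nd Nb cc rr (fun p => z (p.2, p.1))

section Core

variable {ι κ : Type*}

/-- Closure properties of a connectivity relation used in the combinatorial core. -/
structure GoodRel (a : ι → ℕ) (b : κ → ℕ)
    (Rel : Multiset (ι × κ) → Multiset (ι × κ) → Prop) : Prop where
  refl : ∀ s, Rel s s
  trans : ∀ s t u, Rel s t → Rel t u → Rel s u
  add : ∀ s t u, Rel s t → Rel (s + u) (t + u)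
  pres : ∀ s t, Rel s t → s.map Prod.fst = t.map Prod.fst ∧ s.map Prod.snd = t.map Prod.snd ∧
    s.countP (fun p => a p.1 = b p.2) = t.countP (fun p => a p.1 = b p.2)
  row : ∀ i i' j j', a i = a i' → Rel {(i, j), (i', j')} {(i, j'), (i', j)}
  col : ∀ i i' j j', b j = b j' → Rel {(i, j), (i', j')} {(i, j'), (i', j)}
  off : ∀ i i' j j', a i ≠ b j → a i' ≠ b j' → a i ≠ b j' → a i' ≠ b j →
    Rel {(i, j), (i', j')} {(i, j'), (i', j)}
  two : ∀ i₁ i₂ i₃ j₁ j₂ j₃, a i₁ ≠ a i₂ → a i₁ ≠ a i₃ → a i₂ ≠ a i₃ →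
    b j₁ ≠ b j₂ → b j₁ ≠ b j₃ → b j₂ ≠ b j₃ → a i₁ ≠ b j₂ → a i₂ ≠ b j₃ → a i₃ ≠ b j₁ →
    a i₁ ≠ b j₃ → a i₂ ≠ b j₁ → a i₃ ≠ b j₂ →
    Rel {(i₁, j₂), (i₂, j₃), (i₃, j₁)} {(i₁, j₃), (i₂, j₁), (i₃, j₂)}
  three : ∀ i₁ i₂ i₃ j₁ j₂ j₃, a i₁ = b j₁ → a i₂ = b j₂ → a i₁ ≠ a i₂ →
    a i₃ ≠ a i₁ → a i₃ ≠ a i₂ → b j₃ ≠ b j₁ → b j₃ ≠ b j₂ →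
    Rel {(i₁, j₁), (i₂, j₃), (i₃, j₂)} {(i₁, j₃), (i₂, j₂), (i₃, j₁)}
  four : ∀ r₁ r₂ r₃ r₄ c₁ c₂ c₃ c₄, a r₁ = b c₁ → a r₂ = b c₁ → a r₃ = b c₂ → a r₄ = b c₂ →
    b c₁ ≠ b c₂ → b c₃ ≠ b c₁ → b c₃ ≠ b c₂ → b c₄ ≠ b c₁ → b c₄ ≠ b c₂ →
    Rel {(r₁, c₁), (r₂, c₂), (r₃, c₃), (r₄, c₄)} {(r₁, c₃), (r₂, c₄), (r₃, c₂), (r₄, c₁)}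
  four' : ∀ r₁ r₂ r₃ r₄ c₁ c₂ c₃ c₄, b c₁ = a r₁ → b c₂ = a r₁ → b c₃ = a r₂ → b c₄ = a r₂ →
    a r₁ ≠ a r₂ → a r₃ ≠ a r₁ → a r₃ ≠ a r₂ → a r₄ ≠ a r₁ → a r₄ ≠ a r₂ →
    Rel {(r₁, c₁), (r₂, c₂), (r₃, c₃), (r₄, c₄)} {(r₃, c₁), (r₄, c₂), (r₂, c₃), (r₁, c₄)}

variable {a : ι → ℕ} {b : κ → ℕ} {Rel : Multiset (ι × κ) → Multiset (ι × κ) → Prop}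

theorem exists_cons2 {α : Type*} {s : Multiset α} {p q : α} (hp : p ∈ s) (hq : q ∈ s)
    (h : p ≠ q) : ∃ u, s = {p, q} + u := by
  obtain ⟨u, rfl⟩ := Multiset.exists_cons_of_mem hp
  rcases Multiset.mem_cons.1 hq with h1 | h1
  · exact absurd h1.symm h
  · obtain ⟨v, rfl⟩ := Multiset.exists_cons_of_mem h1
    exact ⟨v, by simp [Multiset.insert_eq_cons]⟩

theorem exists_cons3 {α : Type*} {s : Multiset α} {p q r : α} (hp : p ∈ s) (hq : q ∈ s)
    (hr : r ∈ s) (h : p ≠ q) (h1 : p ≠ r) (h2 : q ≠ r) : ∃ u, s = {p, q, r} + u := by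
  obtain ⟨u, rfl⟩ := exists_cons2 hp hq h
  have : r ∈ u := by
    simp only [Multiset.insert_eq_cons, Multiset.mem_add, Multiset.mem_cons,
      Multiset.mem_singleton] at hr
    rcases hr with (hr | hr) | hr
    · exact absurd hr.symm h1
    · exact absurd hr.symm h2
    · exact hr
  obtain ⟨v, rfl⟩ := Multiset.exists_cons_of_mem this
  refine ⟨v, ?_⟩
  simp only [Multiset.insert_eq_cons, Multiset.cons_add, Multiset.singleton_add,
    Multiset.add_cons]
  first | done | rw [Multiset.cons_swap r p, Multiset.cons_swap r q]

/-- The case where `s` and `t` meet a common block. -/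
theorem GoodRel.share (G : GoodRel a b Rel) {s t : Multiset (ι × κ)}
    (h1 : s.map Prod.fst = t.map Prod.fst) (h2 : s.map Prod.snd = t.map Prod.snd)
    {c d : ι × κ} (hc : c ∈ s) (hd : d ∈ t) (ha : a c.1 = a d.1) (hb : b c.2 = b d.2) :
    ∃ s', Rel s s' ∧ d ∈ s' := by
  obtain ⟨i₁, j₁⟩ := c
  obtain ⟨i, j⟩ := d
  simp only at ha hb
  obtain ⟨s₁, hs₁, hm₁⟩ : ∃ s', Rel s s' ∧ (i, j₁) ∈ s' := by
    have : i ∈ s.map Prod.fst := by rw [h1]; exact Multiset.mem_map_of_mem Prod.fst hd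
    obtain ⟨⟨i', j₂⟩, hm, rfl⟩ := Multiset.mem_map.1 this
    by_cases hne : (i₁, j₁) = (i', j₂)
    · exact ⟨s, G.refl s, by simp_all⟩
    obtain ⟨u, rfl⟩ := exists_cons2 hc hm hne
    exact ⟨_, G.add _ _ u (G.row i₁ i' j₁ j₂ ha), by simp⟩
  have : j ∈ s₁.map Prod.snd := by
    rw [← (G.pres _ _ hs₁).2.1, h2]; exact Multiset.mem_map_of_mem Prod.snd hd
  obtain ⟨⟨i₂, j'⟩, hm, rfl⟩ := Multiset.mem_map.1 this
  by_cases hne : (i, j₁) = (i₂, j')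
  · exact ⟨s₁, hs₁, by simp_all⟩
  obtain ⟨u, rfl⟩ := exists_cons2 hm₁ hm hne
  exact ⟨_, G.trans _ _ _ hs₁ (G.add _ _ u (G.col i i₂ j₁ j' hb)), by simp⟩

theorem GoodRel.swap (G : GoodRel a b Rel) {s : Multiset (ι × κ)} {i i' : ι} {j j' : κ}
    (h : (i, j) ∈ s) (h' : (i', j') ∈ s) (hne : (i, j) ≠ (i', j'))
    (h1 : a i ≠ b j) (h2 : a i' ≠ b j') (h3 : a i ≠ b j') (h4 : a i' ≠ b j) :
    ∃ s', Rel s s' ∧ (i, j') ∈ s' ∧ (i', j) ∈ s' ∧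
      ∀ p ∈ s, p ≠ (i, j) → p ≠ (i', j') → p ∈ s' := by
  obtain ⟨u, rfl⟩ := exists_cons2 h h' hne
  refine ⟨_, G.add _ _ u (G.off i i' j j' h1 h2 h3 h4), by simp, by simp, ?_⟩
  intro p hp h5 h6
  simp only [Multiset.insert_eq_cons, Multiset.mem_add, Multiset.mem_cons,
      Multiset.mem_singleton] at hp ⊢
  tauto

/-- If the diagonal is not used, one can reach a common block. -/
theorem GoodRel.nodiag (G : GoodRel a b Rel) {s t : Multiset (ι × κ)}
    (h1 : s.map Prod.fst = t.map Prod.fst) (h2 : s.map Prod.snd = t.map Prod.snd)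
    (hs : ∀ p ∈ s, a p.1 ≠ b p.2) (ht : ∀ p ∈ t, a p.1 ≠ b p.2)
    (hdis : ∀ c ∈ s, ∀ d ∈ t, ¬ (a c.1 = a d.1 ∧ b c.2 = b d.2)) (hne : s ≠ 0) :
    ∃ s', Rel s s' ∧ ∃ c ∈ s', ∃ d ∈ t, a c.1 = a d.1 ∧ b c.2 = b d.2 := by
  have hrow : ∀ i j, (i, j) ∈ s → ∃ j', (i, j') ∈ t := by
    intro i j h
    have : i ∈ t.map Prod.fst := by rw [← h1]; exact Multiset.mem_map_of_mem Prod.fst h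
    obtain ⟨⟨i', j₂⟩, hm, rfl⟩ := Multiset.mem_map.1 this
    exact ⟨j₂, hm⟩
  have hcol : ∀ i j, (i, j) ∈ t → ∃ i', (i', j) ∈ s := by
    intro i j h
    have : j ∈ s.map Prod.snd := by rw [h2]; exact Multiset.mem_map_of_mem Prod.snd h
    obtain ⟨⟨i', j₂⟩, hm, rfl⟩ := Multiset.mem_map.1 this
    exact ⟨i', hm⟩
  obtain ⟨⟨i₁, j₁⟩, p1⟩ := Multiset.exists_mem_of_ne_zero hne
  obtain ⟨j₂, q1⟩ := hrow _ _ p1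
  obtain ⟨i₂, p2⟩ := hcol _ _ q1
  obtain ⟨j₃, q2⟩ := hrow _ _ p2
  obtain ⟨i₃, p3⟩ := hcol _ _ q2
  have a1 := hs _ p1
  have a2 := hs _ p2
  have a3 := hs _ p3
  have b1 := ht _ q1
  have b2 := ht _ q2
  have c1 := hdis _ p1 _ q1
  have c2 := hdis _ p2 _ q1
  have c3 := hdis _ p2 _ q2
  have c4 := hdis _ p3 _ q2
  simp only at a1 a2 a3 b1 b2 c1 c2 c3 c4
  by_cases e1 : a i₂ = b j₁
  · by_cases e2 : a i₃ = b j₂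
    · have n12 : (i₁, j₁) ≠ (i₂, j₂) := by rintro h; simp only [Prod.mk.injEq] at h; grind
      have n13 : (i₁, j₁) ≠ (i₃, j₃) := by rintro h; simp only [Prod.mk.injEq] at h; grind
      have n23 : (i₂, j₂) ≠ (i₃, j₃) := by rintro h; simp only [Prod.mk.injEq] at h; grind
      obtain ⟨u, rfl⟩ := exists_cons3 p1 p2 p3 n12 n13 n23
      exact ⟨_, G.add _ _ u (G.two i₁ i₂ i₃ j₃ j₁ j₂ (by grind) (by grind) (by grind)
        (by grind) (by grind) (by grind) (by grind) (by grind) (by grind) (by grind)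
        (by grind) (by grind)), (i₁, j₂), by simp, _, q1, rfl, rfl⟩
    · obtain ⟨s', r, m, -⟩ := G.swap p2 p3 (by grind) a2 a3 b2 e2
      exact ⟨s', r, _, m, _, q2, rfl, rfl⟩
  · obtain ⟨s', r, m, -⟩ := G.swap p1 p2 (by grind) a1 a2 b1 e1
    exact ⟨s', r, _, m, _, q1, rfl, rfl⟩

theorem GoodRel.caseA (G : GoodRel a b Rel) {s : Multiset (ι × κ)} {k l : ℕ} (hkl : k ≠ l)
    {p q r : ι × κ} (hp : p ∈ s) (hp1 : a p.1 = k) (hp2 : b p.2 = k)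
    (hq : q ∈ s) (hq1 : a q.1 = l) (hq2 : b q.2 ≠ k) (hq3 : b q.2 ≠ l)
    (hr : r ∈ s) (hr1 : b r.2 = l) (hr2 : a r.1 ≠ k) (hr3 : a r.1 ≠ l) :
    ∃ s', Rel s s' ∧ ∃ d ∈ s', a d.1 = l ∧ b d.2 = l := by
  obtain ⟨u, rfl⟩ := exists_cons3 hp hq hr (by grind) (by grind) (by grind)
  exact ⟨_, G.add _ _ u (G.three p.1 q.1 r.1 p.2 r.2 q.2 (by grind) (by grind) (by grind)
    (by grind) (by grind) (by grind) (by grind)), (q.1, r.2), by simp, hq1, hr1⟩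

theorem exists_two {α : Type*} {s : Multiset α} {P : α → Prop} [DecidablePred P]
    (h : 2 ≤ s.countP P) {p : α} (hp : p ∈ s) : ∃ q u, s = {p, q} + u ∧ P q := by
  obtain ⟨u, rfl⟩ := Multiset.exists_cons_of_mem hp
  have : 0 < u.countP P := by
    rw [Multiset.countP_cons] at h
    split_ifs at h <;> omega
  obtain ⟨q, hq, hP⟩ := Multiset.countP_pos.1 this
  obtain ⟨v, rfl⟩ := Multiset.exists_cons_of_mem hq
  exact ⟨q, v, by simp [Multiset.insert_eq_cons], hP⟩

theorem count_identity (k : ℕ) (s : Multiset (ι × κ)) :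
    s.countP (fun p => a p.1 ≠ b p.2 ∧ a p.1 ≠ k ∧ b p.2 ≠ k) +
      (s.map Prod.fst).countP (fun i => a i = k) + (s.map Prod.snd).countP (fun j => b j = k) +
      s.countP (fun p => a p.1 = b p.2) =
    s.card + 2 * s.countP (fun p => a p.1 = k ∧ b p.2 = k) := by
  induction s using Multiset.induction with
  | empty => simp
  | cons p s ih =>
    simp only [Multiset.map_cons, Multiset.countP_cons, Multiset.card_cons]
    split_ifs <;> grind

theorem GoodRel.caseB (G : GoodRel a b Rel) {s : Multiset (ι × κ)} {k l : ℕ} (hkl : k ≠ l)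
    (hn : 2 ≤ s.countP (fun p => a p.1 ≠ b p.2 ∧ a p.1 ≠ k ∧ b p.2 ≠ k))
    {p q r : ι × κ} (hp : p ∈ s) (hp1 : a p.1 = k) (hp2 : b p.2 = k)
    (hq : q ∈ s) (hq1 : a q.1 = l) (hq3 : b q.2 ≠ l)
    (hr : r ∈ s) (hr1 : b r.2 = l) (hr2 : a r.1 ≠ k) (hr3 : a r.1 ≠ l) :
    ∃ s', Rel s s' ∧ ∃ d ∈ s', a d.1 = l ∧ b d.2 = l := by
  by_cases hq2 : b q.2 = k
  swap
  · exact G.caseA hkl hp hp1 hp2 hq hq1 hq2 hq3 hr hr1 hr2 hr3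
  obtain ⟨w, u, rfl, hw1, hw2, hw3⟩ := exists_two hn hr
  have hwm : w ∈ ({r, w} : Multiset (ι × κ)) + u := by simp
  by_cases hw4 : a w.1 = l
  · exact G.caseA hkl hp hp1 hp2 hwm hw4 hw3 (by grind) hr hr1 hr2 hr3
  by_cases hw5 : b w.2 = l
  · have hpu : p ∈ u := by
      simp only [Multiset.insert_eq_cons, Multiset.mem_add, Multiset.mem_cons,
        Multiset.mem_singleton] at hp
      grind
    have hqu : q ∈ u := by
      simp only [Multiset.insert_eq_cons, Multiset.mem_add, Multiset.mem_cons,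
        Multiset.mem_singleton] at hq
      grind
    obtain ⟨v, rfl⟩ := exists_cons2 hpu hqu (by grind)
    have h := G.add _ _ v (G.four' p.1 q.1 r.1 w.1 p.2 q.2 r.2 w.2 (by grind) (by grind)
      (by grind) (by grind) (by grind) (by grind) (by grind) (by grind) (by grind))
    have e : ({r, w} : Multiset (ι × κ)) + ({p, q} + v) =
        {(p.1, p.2), (q.1, q.2), (r.1, r.2), (w.1, w.2)} + v := by
      rw [← add_assoc, add_comm ({r, w} : Multiset (ι × κ))]; rfl
    rw [e]
    exact ⟨_, h, (q.1, r.2), by simp, hq1, hr1⟩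
  · obtain ⟨s', h1, h2, h3, h4⟩ := G.swap (i := q.1) (j := q.2) (i' := w.1) (j' := w.2)
      hq hwm (by grind) (by grind) (by grind) (by grind) (by grind)
    obtain ⟨s'', h5, h6⟩ := G.caseA hkl (h4 p hp (by grind) (by grind)) hp1 hp2 h2 hq1 hw3 hw5
      (h4 r hr (by grind) (by grind)) hr1 hr2 hr3
    exact ⟨s'', G.trans _ _ _ h1 h5, h6⟩

theorem GoodRel.caseB' (G : GoodRel a b Rel) {s : Multiset (ι × κ)} {k l : ℕ} (hkl : k ≠ l)
    (hn : 2 ≤ s.countP (fun p => a p.1 ≠ b p.2 ∧ a p.1 ≠ k ∧ b p.2 ≠ k))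
    {p q r : ι × κ} (hp : p ∈ s) (hp1 : a p.1 = k) (hp2 : b p.2 = k)
    (hq : q ∈ s) (hq1 : a q.1 = l) (hq2 : b q.2 ≠ k) (hq3 : b q.2 ≠ l)
    (hr : r ∈ s) (hr1 : b r.2 = l) (hr3 : a r.1 ≠ l) :
    ∃ s', Rel s s' ∧ ∃ d ∈ s', a d.1 = l ∧ b d.2 = l := by
  by_cases hr2 : a r.1 = k
  swap
  · exact G.caseA hkl hp hp1 hp2 hq hq1 hq2 hq3 hr hr1 hr2 hr3
  obtain ⟨w, u, rfl, hw1, hw2, hw3⟩ := exists_two hn hq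
  have hwm : w ∈ ({q, w} : Multiset (ι × κ)) + u := by simp
  by_cases hw4 : b w.2 = l
  · exact G.caseA hkl hp hp1 hp2 hq hq1 hq2 hq3 hwm hw4 hw2 (by grind)
  by_cases hw5 : a w.1 = l
  · have hpu : p ∈ u := by
      simp only [Multiset.insert_eq_cons, Multiset.mem_add, Multiset.mem_cons,
        Multiset.mem_singleton] at hp
      grind
    have hru : r ∈ u := by
      simp only [Multiset.insert_eq_cons, Multiset.mem_add, Multiset.mem_cons,
        Multiset.mem_singleton] at hr
      grind
    obtain ⟨v, rfl⟩ := exists_cons2 hpu hru (by grind)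
    have h := G.add _ _ v (G.four p.1 r.1 q.1 w.1 p.2 r.2 q.2 w.2 (by grind) (by grind)
      (by grind) (by grind) (by grind) (by grind) (by grind) (by grind) (by grind))
    have e : ({q, w} : Multiset (ι × κ)) + ({p, r} + v) =
        {(p.1, p.2), (r.1, r.2), (q.1, q.2), (w.1, w.2)} + v := by
      rw [← add_assoc, add_comm ({q, w} : Multiset (ι × κ))]; rfl
    rw [e]
    exact ⟨_, h, (q.1, r.2), by simp, hq1, hr1⟩
  · obtain ⟨s', h1, h2, h3, h4⟩ := G.swap (i := r.1) (j := r.2) (i' := w.1) (j' := w.2)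
      hr hwm (by grind) (by grind) (by grind) (by grind) (by grind)
    obtain ⟨s'', h5, h6⟩ := G.caseA hkl (h4 p hp (by grind) (by grind)) hp1 hp2
      (h4 q hq (by grind) (by grind)) hq1 hq2 hq3 h3 hr1 hw2 hw5
    exact ⟨s'', G.trans _ _ _ h1 h5, h6⟩

theorem GoodRel.transfer (G : GoodRel a b Rel) {s : Multiset (ι × κ)} {k l : ℕ} (hkl : k ≠ l)
    (hn : 2 ≤ s.countP (fun p => a p.1 ≠ b p.2 ∧ a p.1 ≠ k ∧ b p.2 ≠ k))
    {p q r : ι × κ} (hp : p ∈ s) (hp1 : a p.1 = k) (hp2 : b p.2 = k)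
    (hq : q ∈ s) (hq1 : a q.1 = l) (hq3 : b q.2 ≠ l)
    (hr : r ∈ s) (hr1 : b r.2 = l) (hr3 : a r.1 ≠ l) :
    ∃ s', Rel s s' ∧ ∃ d ∈ s', a d.1 = l ∧ b d.2 = l := by
  by_cases hr2 : a r.1 = k
  swap
  · exact G.caseB hkl hn hp hp1 hp2 hq hq1 hq3 hr hr1 hr2 hr3
  by_cases hq2 : b q.2 = k
  swap
  · exact G.caseB' hkl hn hp hp1 hp2 hq hq1 hq2 hq3 hr hr1 hr3
  obtain ⟨w, hw, hw1, hw2, hw3⟩ := Multiset.countP_pos.1 (lt_of_lt_of_le two_pos hn)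
  by_cases hw4 : b w.2 = l
  · exact G.caseB hkl hn hp hp1 hp2 hq hq1 hq3 hw hw4 hw2 (by grind)
  by_cases hw5 : a w.1 = l
  · exact G.caseB' hkl hn hp hp1 hp2 hw hw5 hw3 hw4 hr hr1 hr3
  obtain ⟨u, hu⟩ : ∃ u, s = {q, w} + u := exists_cons2 hq hw (by grind)
  subst hu
  have hsw := G.add _ _ u (G.off q.1 w.1 q.2 w.2 (by grind) (by grind) (by grind) (by grind))
  have hmem : ∀ x, x ∈ ({q, w} : Multiset (ι × κ)) + u → x ≠ q → x ≠ w → x ∈ u := by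
    intro x hx e1 e2
    simp only [Multiset.insert_eq_cons, Multiset.mem_add, Multiset.mem_cons,
        Multiset.mem_singleton] at hx
    tauto
  obtain ⟨s'', h5, h6⟩ := G.caseB' (s := {(q.1, w.2), (w.1, q.2)} + u) hkl (by
      simp only [Multiset.insert_eq_cons, Multiset.cons_add, Multiset.singleton_add,
        Multiset.countP_cons] at hn ⊢
      split_ifs at hn ⊢ <;> grind)
    (Multiset.mem_add.2 (Or.inr (hmem p hp (by grind) (by grind)))) hp1 hp2
    (q := (q.1, w.2)) (by simp) hq1 hw3 hw4
    (Multiset.mem_add.2 (Or.inr (hmem r hr (by grind) (by grind)))) hr1 hr3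
  exact ⟨s'', G.trans _ _ _ hsw h5, h6⟩

theorem GoodRel.diag (G : GoodRel a b Rel) {s t : Multiset (ι × κ)}
    (h1 : s.map Prod.fst = t.map Prod.fst) (h2 : s.map Prod.snd = t.map Prod.snd)
    (h3 : s.countP (fun p => a p.1 = b p.2) = t.countP (fun p => a p.1 = b p.2))
    (hdis : ∀ c ∈ s, ∀ d ∈ t, ¬ (a c.1 = a d.1 ∧ b c.2 = b d.2))
    {p : ι × κ} (hp : p ∈ s) (hpd : a p.1 = b p.2) :
    ∃ s', Rel s s' ∧ ∃ c ∈ s', ∃ d ∈ t, a c.1 = a d.1 ∧ b c.2 = b d.2 := by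
  have hpos : 0 < t.countP (fun p => a p.1 = b p.2) := by
    rw [← h3]; exact Multiset.countP_pos.2 ⟨p, hp, hpd⟩
  obtain ⟨d, hd, hdd⟩ := Multiset.countP_pos.1 hpos
  have hkl : a p.1 ≠ a d.1 := fun h => hdis p hp d hd ⟨h, by grind⟩
  have m1 : d.1 ∈ s.map Prod.fst := by rw [h1]; exact Multiset.mem_map_of_mem Prod.fst hd
  have m2 : d.2 ∈ s.map Prod.snd := by rw [h2]; exact Multiset.mem_map_of_mem Prod.snd hd
  obtain ⟨q, hq, hqd⟩ := Multiset.mem_map.1 m1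
  obtain ⟨r, hr, hrd⟩ := Multiset.mem_map.1 m2
  have hn : 2 ≤ s.countP (fun x => a x.1 ≠ b x.2 ∧ a x.1 ≠ a p.1 ∧ b x.2 ≠ a p.1) := by
    have i1 := count_identity (a := a) (b := b) (a p.1) s
    have i2 := count_identity (a := a) (b := b) (a p.1) t
    have i3 : s.card = t.card := by
      rw [← Multiset.card_map Prod.fst s, h1, Multiset.card_map]
    have i4 : 0 < s.countP (fun x => a x.1 = a p.1 ∧ b x.2 = a p.1) :=
      Multiset.countP_pos.2 ⟨p, hp, rfl, hpd.symm⟩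
    have i5 : t.countP (fun x => a x.1 = a p.1 ∧ b x.2 = a p.1) = 0 := by
      rw [Multiset.countP_eq_zero]
      intro x hx hx'
      exact hdis p hp x hx ⟨hx'.1.symm, by grind⟩
    rw [h1, h2, h3] at i1
    omega
  obtain ⟨s', r1, c, hc, hc1, hc2⟩ := G.transfer hkl hn hp rfl hpd.symm hq (by rw [hqd])
    (fun h => hdis q hq d hd ⟨by rw [hqd], by grind⟩) hr (by rw [hrd, hdd])
    (fun h => hdis r hr d hd ⟨h, by rw [hrd]⟩)
  exact ⟨s', r1, c, hc, d, hd, hc1, by grind⟩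

theorem GoodRel.conn (G : GoodRel a b Rel) : ∀ (n : ℕ) (s t : Multiset (ι × κ)), s.card = n →
    s.map Prod.fst = t.map Prod.fst → s.map Prod.snd = t.map Prod.snd →
    s.countP (fun p => a p.1 = b p.2) = t.countP (fun p => a p.1 = b p.2) → Rel s t := by
  intro n
  induction n with
  | zero =>
    intro s t hs h1 h2 h3
    have i3 : s.card = t.card := by
      rw [← Multiset.card_map Prod.fst s, h1, Multiset.card_map]
    have e1 : s = 0 := Multiset.card_eq_zero.1 hs
    have e2 : t = 0 := Multiset.card_eq_zero.1 (by omega)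
    rw [e1, e2]; exact G.refl 0
  | succ n ih =>
    intro s t hs h1 h2 h3
    -- reach a common block
    obtain ⟨s₁, r1, c, hc, d, hd, hcd1, hcd2⟩ :
        ∃ s', Rel s s' ∧ ∃ c ∈ s', ∃ d ∈ t, a c.1 = a d.1 ∧ b c.2 = b d.2 := by
      by_cases hdis : ∀ c ∈ s, ∀ d ∈ t, ¬ (a c.1 = a d.1 ∧ b c.2 = b d.2)
      · by_cases hsd : ∀ p ∈ s, a p.1 ≠ b p.2
        · refine G.nodiag h1 h2 hsd ?_ hdis ?_
          · have : s.countP (fun p => a p.1 = b p.2) = 0 := Multiset.countP_eq_zero.2 hsd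
            rw [h3] at this
            exact Multiset.countP_eq_zero.1 this
          · rintro rfl; simp at hs
        · push Not at hsd
          obtain ⟨p, hp, hpd⟩ := hsd
          exact G.diag h1 h2 h3 hdis hp hpd
      · push Not at hdis
        obtain ⟨c, hc, d, hd, hh⟩ := hdis
        exact ⟨s, G.refl s, c, hc, d, hd, hh⟩
    obtain ⟨p1, p2, p3⟩ := G.pres _ _ r1
    obtain ⟨s₂, r2, hm⟩ := G.share (p1.symm.trans h1) (p2.symm.trans h2) hc hd hcd1 hcd2
    obtain ⟨q1, q2, q3⟩ := G.pres _ _ r2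
    obtain ⟨u, rfl⟩ := Multiset.exists_cons_of_mem hm
    obtain ⟨v, rfl⟩ := Multiset.exists_cons_of_mem hd
    have e1 := (p1.trans q1).symm.trans h1
    have e2 := (p2.trans q2).symm.trans h2
    have e3 := (p3.trans q3).symm.trans h3
    have ec : s.card = (d ::ₘ u).card := by
      rw [← Multiset.card_map Prod.fst s, p1.trans q1, Multiset.card_map]
    simp only [Multiset.map_cons, Multiset.cons_inj_right] at e1 e2
    simp only [Multiset.countP_cons, Nat.add_right_cancel_iff] at e3
    rw [Multiset.card_cons] at ec
    have := G.add _ _ {d} (ih u v (by omega) e1 e2 e3)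
    rw [Multiset.add_comm u, Multiset.add_comm v, Multiset.singleton_add,
      Multiset.singleton_add] at this
    exact G.trans _ _ _ (G.trans _ _ _ r1 r2) this

end Core
section Glue

/-- The table of a multiset of cells. -/
def tab {R C : ℕ} (s : Multiset (Fin R × Fin C)) : Table R C := fun p => (s.count p : ℤ)

theorem tab_add {R C : ℕ} (s t : Multiset (Fin R × Fin C)) : tab (s + t) = tab s + tab t := by
  funext p; simp [tab]

theorem tab_cons {R C : ℕ} (p : Fin R × Fin C) (t : Multiset (Fin R × Fin C)) :
    tab (p ::ₘ t) = e p + tab t := by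
  funext q
  simp only [tab, Multiset.count_cons, Pi.add_apply, e]
  split_ifs <;> push_cast <;> ring

theorem tab_singleton {R C : ℕ} (p : Fin R × Fin C) : tab {p} = e p := by
  funext q
  simp only [tab, Multiset.count_singleton, e]
  split_ifs <;> simp

theorem exists_tab {R C : ℕ} (x : Table R C) (hx : ∀ p, 0 ≤ x p) : ∃ s, tab s = x := by
  refine ⟨∑ p, Multiset.replicate (x p).toNat p, ?_⟩
  funext q
  simp only [tab, Multiset.count_sum', Multiset.count_replicate]
  simp [hx q]

theorem configMap_add {R C N : ℕ} (S : Fin N → Finset (Fin R × Fin C)) (x y : Table R C) :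
    configMap S (x + y) = configMap S x + configMap S y := by
  simp only [configMap, Pi.add_apply, Finset.sum_add_distrib]; rfl

theorem configMap_sub {R C N : ℕ} (S : Fin N → Finset (Fin R × Fin C)) (x y : Table R C) :
    configMap S (x - y) = configMap S x - configMap S y := by
  simp only [configMap, Pi.sub_apply, Finset.sum_sub_distrib]; rfl

theorem configMap_tab {R C : ℕ} (S : Finset (Fin R × Fin C)) (s : Multiset (Fin R × Fin C)) :
    configMap (fun _ : Fin 1 => S) (tab s) =
      (fun i => ((s.map Prod.fst).count i : ℤ), fun j => ((s.map Prod.snd).count j : ℤ),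
        fun _ => (s.countP (· ∈ S) : ℤ)) := by
  induction s using Multiset.induction with
  | empty => simp [configMap, tab]
  | cons p s ih =>
    rw [tab_cons, configMap_add, ih]
    obtain ⟨i, j⟩ := p
    refine Prod.ext ?_ (Prod.ext ?_ ?_)
    · funext i'
      simp only [configMap, e, Prod.fst_add, Pi.add_apply, Multiset.map_cons,
        Multiset.count_cons, Prod.mk.injEq]
      by_cases h : i' = i <;> simp [h, add_comm]
    · funext j'
      simp only [configMap, e, Prod.fst_add, Prod.snd_add, Pi.add_apply, Multiset.map_cons,
        Multiset.count_cons, Prod.mk.injEq]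
      by_cases h : j' = j <;> simp [h, add_comm]
    · funext n
      simp only [configMap, e, Prod.snd_add, Pi.add_apply,
        Multiset.countP_cons, Finset.sum_ite_eq']
      by_cases h : (i, j) ∈ S <;> simp [h, add_comm]

theorem configMap_tab_eq {R C : ℕ} (S : Finset (Fin R × Fin C)) (s t : Multiset (Fin R × Fin C)) :
    configMap (fun _ : Fin 1 => S) (tab s) = configMap (fun _ : Fin 1 => S) (tab t) ↔
      s.map Prod.fst = t.map Prod.fst ∧ s.map Prod.snd = t.map Prod.snd ∧
        s.countP (· ∈ S) = t.countP (· ∈ S) := by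
  rw [configMap_tab, configMap_tab]
  simp only [Prod.mk.injEq, funext_iff, Nat.cast_inj, Multiset.ext, forall_const]

theorem isMove_tab {R C : ℕ} (S : Finset (Fin R × Fin C)) (s t : Multiset (Fin R × Fin C)) :
    IsMove (fun _ : Fin 1 => S) (tab t - tab s) ↔
      s.map Prod.fst = t.map Prod.fst ∧ s.map Prod.snd = t.map Prod.snd ∧
        s.countP (· ∈ S) = t.countP (· ∈ S) := by
  rw [IsMove, configMap_sub, sub_eq_zero, eq_comm, configMap_tab_eq]

theorem path_of_rel {R C : ℕ} (S : Finset (Fin R × Fin C)) (B : Set (Table R C))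
    (hB : ∀ z ∈ B, IsMove (fun _ : Fin 1 => S) z) (s t : Multiset (Fin R × Fin C))
    (h : Relation.ReflTransGen (fun s t => tab t - tab s ∈ B) s t) :
    ∃ U : ℕ, ∃ zs : Fin U → Table R C, (∀ u, zs u ∈ B) ∧ tab t = tab s + ∑ u, zs u ∧
      configMap (fun _ : Fin 1 => S) (tab t) = configMap (fun _ : Fin 1 => S) (tab s) ∧
      ∀ u : Fin U, (tab s + ∑ v ∈ Finset.Iic u, zs v) ∈
        Fiber (fun _ : Fin 1 => S) (configMap (fun _ : Fin 1 => S) (tab s)) := by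
  induction h with
  | refl => exact ⟨0, Fin.elim0, fun u => u.elim0, by simp, rfl, fun u => u.elim0⟩
  | @tail t t' _ hst ih =>
    obtain ⟨U, zs, h1, h2, h3, h4⟩ := ih
    have hc : configMap (fun _ : Fin 1 => S) (tab t') = configMap (fun _ : Fin 1 => S) (tab s) := by
      have := hB _ hst
      rw [IsMove, configMap_sub, sub_eq_zero] at this
      rw [this, h3]
    have hsum : tab t' = tab s + ∑ u, (Fin.snoc zs (tab t' - tab t) : Fin (U+1) → Table R C) u := by
      rw [Fin.sum_univ_castSucc]
      simp only [Fin.snoc_castSucc, Fin.snoc_last]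
      rw [← add_assoc, ← h2]; abel
    refine ⟨U + 1, Fin.snoc zs (tab t' - tab t), ?_, hsum, hc, ?_⟩
    · intro u
      refine Fin.lastCases ?_ (fun v => ?_) u
      · simpa using hst
      · simpa using h1 v
    · intro u
      refine Fin.lastCases ?_ (fun v => ?_) u
      · have : (Finset.Iic (Fin.last U)) = Finset.univ := by
          ext x; simp [Fin.le_last]
        rw [this, ← hsum]
        exact ⟨fun p => by simp [tab], hc⟩
      · have : ∑ w ∈ Finset.Iic v.castSucc,
            (Fin.snoc zs (tab t' - tab t) : Fin (U+1) → Table R C) w = ∑ w ∈ Finset.Iic v, zs w := by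
          have e1 : ∀ (n : ℕ) (v : Fin n), Finset.Iic v = Finset.univ.filter (· ≤ v) := by
            intro n v; ext x; simp
          rw [e1, e1, Finset.sum_filter, Finset.sum_filter, Fin.sum_univ_castSucc]
          have : ¬ (Fin.last U ≤ v.castSucc) := by
            simpa using Fin.castSucc_lt_last v
          simp [this]
        rw [this]
        exact h4 v

theorem exists_class (R N : ℕ) (rr : ℕ → ℕ) (hr1 : rr 1 = 1)
    (hrmono : ∀ n, 1 ≤ n → n ≤ N → rr n < rr (n + 1)) (hrtop : rr (N + 1) = R + 1) :
    ∃ a : Fin R → ℕ, (∀ i, 1 ≤ a i ∧ a i ≤ N) ∧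
      ∀ i k, 1 ≤ k → k ≤ N → ((rr k ≤ i.1 + 1 ∧ i.1 + 1 < rr (k + 1)) ↔ a i = k) := by
  have mono : ∀ d k, 1 ≤ k → k + d ≤ N + 1 → rr k ≤ rr (k + d) := by
    intro d
    induction d with
    | zero => intro k _ _; exact le_rfl
    | succ d ih =>
      intro k h1 h2
      have := ih k h1 (by omega)
      have := hrmono (k + d) (by omega) (by omega)
      rw [← add_assoc]; omega
  have mono' : ∀ k l, 1 ≤ k → k ≤ l → l ≤ N + 1 → rr k ≤ rr l := by
    intro k l h1 h2 h3
    obtain ⟨d, rfl⟩ := Nat.exists_eq_add_of_le h2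
    exact mono d k h1 h3
  have ex : ∀ i : Fin R, ∃ k, 1 ≤ k ∧ k ≤ N ∧ rr k ≤ i.1 + 1 ∧ i.1 + 1 < rr (k + 1) := by
    intro i
    have hex : ∃ k, i.1 + 1 < rr (k + 1) ∧ 1 ≤ k := by
      refine ⟨N, ?_, ?_⟩
      · rw [hrtop]; have := i.2; omega
      · rcases Nat.eq_zero_or_pos N with h | h
        · subst h; have := i.2; simp only [zero_add] at hrtop; omega
        · exact h
    classical
    obtain ⟨f1, f2⟩ := Nat.find_spec hex
    refine ⟨Nat.find hex, f2, ?_, ?_, f1⟩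
    · apply Nat.find_min' hex
      refine ⟨?_, ?_⟩
      · rw [hrtop]; have := i.2; omega
      · rcases Nat.eq_zero_or_pos N with h | h
        · subst h; have := i.2; simp only [zero_add] at hrtop; omega
        · exact h
    · by_contra hcon
      push Not at hcon
      rcases Nat.lt_or_ge (Nat.find hex) 2 with h | h
      · have : Nat.find hex = 1 := by omega
        rw [this, hr1] at hcon; omega
      · refine Nat.find_min hex (m := Nat.find hex - 1) (by omega) ⟨?_, by omega⟩
        rw [Nat.sub_add_cancel f2]; exact hcon
  choose a h1 h2 h3 h4 using ex
  refine ⟨a, fun i => ⟨h1 i, h2 i⟩, fun i k hk1 hk2 => ⟨?_, ?_⟩⟩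
  · rintro ⟨g1, g2⟩
    have i3 := h3 i
    have i4 := h4 i
    have i1 := h1 i
    have i2 := h2 i
    rcases lt_trichotomy (a i) k with h | h | h
    · have := mono' (a i + 1) k (by omega) (by omega) (by omega); omega
    · exact h
    · have := mono' (k + 1) (a i) (by omega) (by omega) (by omega); omega
  · rintro rfl; exact ⟨h3 i, h4 i⟩

end Glue
theorem isBasicMove_neg {R C : ℕ} {z : Table R C} (h : IsBasicMove z) : IsBasicMove (-z) := by
  obtain ⟨i, i', j, j', h1, h2, rfl⟩ := h
  exact ⟨i', i, j, j', h1.symm, h2, by abel⟩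

theorem sameBlock_symm {R C N : ℕ} {rr cc : ℕ → ℕ} {p q : Fin R × Fin C}
    (h : SameBlock N rr cc p q) : SameBlock N rr cc q p := by
  obtain ⟨k, l, h1, h2, h3, h4, h5, h6⟩ := h
  exact ⟨k, l, h1, h2, h3, h4, h6, h5⟩

theorem isTypeII_neg {R C N : ℕ} {rr cc : ℕ → ℕ} {z : Table R C} (h : IsTypeII N N rr cc z) :
    IsTypeII N N rr cc (-z) := by
  obtain ⟨i₁, i₂, i₃, j₁, j₂, j₃, rfl, h1, h2⟩ := h
  refine ⟨i₁, i₃, i₂, j₁, j₃, j₂, by abel, fun p hp => h1 p ?_, ?_⟩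
  · simp only [List.mem_cons, List.not_mem_nil, or_false] at hp ⊢; tauto
  · have hs : ∀ p q : Fin R × Fin C, ¬ SameBlock N rr cc p q → ¬ SameBlock N rr cc q p :=
      fun p q h h' => h (sameBlock_symm h')
    refine List.Pairwise.perm (R := fun p q : Fin R × Fin C => ¬ SameBlock N rr cc p q) h2 ?_
      (fun {p q} h => hs p q h)
    rw [← Multiset.coe_eq_coe]
    simp only [← Multiset.cons_coe, Multiset.coe_nil, ← Multiset.singleton_add]
    abel

theorem isTypeIII_neg {R C N : ℕ} {rr cc : ℕ → ℕ} {z : Table R C} (h : IsTypeIII N N rr cc z) :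
    IsTypeIII N N rr cc (-z) := by
  obtain ⟨i₁, i₂, i₃, j₁, j₂, j₃, rfl, ⟨k, l, g1, g2, g3, g4, g5, g6, g7⟩, h1, h2⟩ := h
  refine ⟨i₂, i₁, i₃, j₂, j₁, j₃, by abel, ⟨l, k, g3, g4, g1, g2, g5.symm, g7, g6⟩,
    fun p hp => h1 p ?_, ?_⟩
  · simp only [List.mem_cons, List.not_mem_nil, or_false] at hp ⊢; tauto
  · have hs : ∀ p q : Fin R × Fin C, ¬ SameBlock N rr cc p q → ¬ SameBlock N rr cc q p :=
      fun p q h h' => h (sameBlock_symm h')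
    refine List.Pairwise.perm (R := fun p q : Fin R × Fin C => ¬ SameBlock N rr cc p q) h2 ?_
      (fun {p q} h => hs p q h)
    rw [← Multiset.coe_eq_coe]
    simp only [← Multiset.cons_coe, Multiset.coe_nil, ← Multiset.singleton_add]
    abel

theorem isTypeIVrow_neg {R C N : ℕ} {rr cc : ℕ → ℕ} {z : Table R C}
    (h : IsTypeIVrow N N rr cc z) : IsTypeIVrow N N rr cc (-z) := by
  obtain ⟨i₁, i₂, i₃, i₄, j₁, j₂, j₃, j₄, rfl, ⟨k, l, g1, g2, g3, g4, g5, g6, g7⟩, h1, h2, h3⟩ := h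
  refine ⟨i₃, i₄, i₁, i₂, j₂, j₁, j₃, j₄, by abel, ⟨l, k, g3, g4, g1, g2, g5.symm, g7, g6⟩,
    fun p hp => h1 p ?_, h3, h2⟩
  simp only [List.mem_cons, List.not_mem_nil, or_false] at hp ⊢; tauto

theorem isTypeIV_neg {R C N : ℕ} {rr cc : ℕ → ℕ} {z : Table R C}
    (h : IsTypeIV N N rr cc z) : IsTypeIV N N rr cc (-z) :=
  h.imp isTypeIVrow_neg isTypeIVrow_neg

theorem e_bd {R C : ℕ} (a p : Fin R × Fin C) : 0 ≤ e a p ∧ e a p ≤ 1 := by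
  unfold e; split_ifs <;> simp

theorem isTypeIVrow_bd {R C N : ℕ} {rr cc : ℕ → ℕ} {z : Table R C}
    (h : IsTypeIVrow N N rr cc z) (p) : -4 ≤ z p ∧ z p ≤ 4 := by
  obtain ⟨i₁, i₂, i₃, i₄, j₁, j₂, j₃, j₄, rfl, -⟩ := h
  simp only [Pi.add_apply, Pi.sub_apply]
  have := e_bd (i₁,j₁) p
  have := e_bd (i₂,j₂) p
  have := e_bd (i₃,j₃) p
  have := e_bd (i₄,j₄) p
  have := e_bd (i₁,j₃) p
  have := e_bd (i₂,j₄) p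
  have := e_bd (i₃,j₂) p
  have := e_bd (i₄,j₁) p
  omega

theorem moves_finite {R C N : ℕ} (rr cc : ℕ → ℕ) (Q : Table R C → Prop) :
    {z : Table R C | (IsBasicMove z ∨ IsTypeII N N rr cc z ∨ IsTypeIII N N rr cc z ∨
            IsTypeIV N N rr cc z) ∧ Q z}.Finite := by
  refine (Set.finite_Icc (fun _ => -4 : Table R C) (fun _ => 4)).subset ?_
  rintro z ⟨hz, -⟩
  suffices h : ∀ p, -4 ≤ z p ∧ z p ≤ 4 from ⟨fun p => (h p).1, fun p => (h p).2⟩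
  rcases hz with h | h | h | h | h
  · obtain ⟨i, i', j, j', h1, h2, rfl⟩ := h
    intro p
    simp only [Pi.add_apply, Pi.sub_apply]
    have := e_bd (i,j) p
    have := e_bd (i',j') p
    have := e_bd (i',j) p
    have := e_bd (i,j') p
    omega
  · obtain ⟨i₁, i₂, i₃, j₁, j₂, j₃, rfl, -⟩ := h
    intro p
    simp only [Pi.add_apply, Pi.sub_apply]
    have := e_bd (i₁,j₂) p
    have := e_bd (i₂,j₃) p
    have := e_bd (i₃,j₁) p
    have := e_bd (i₁,j₃) p
    have := e_bd (i₂,j₁) p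
    have := e_bd (i₃,j₂) p
    omega
  · obtain ⟨i₁, i₂, i₃, j₁, j₂, j₃, rfl, -⟩ := h
    intro p
    simp only [Pi.add_apply, Pi.sub_apply]
    have := e_bd (i₁,j₁) p
    have := e_bd (i₂,j₃) p
    have := e_bd (i₃,j₂) p
    have := e_bd (i₁,j₃) p
    have := e_bd (i₂,j₂) p
    have := e_bd (i₃,j₁) p
    omega
  · exact isTypeIVrow_bd h
  · intro p; exact isTypeIVrow_bd h (p.2, p.1)

theorem mem_block_iff {R C N : ℕ} {rr cc : ℕ → ℕ} {a : Fin R → ℕ} {b : Fin C → ℕ}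
    (ha : ∀ i k, 1 ≤ k → k ≤ N → ((rr k ≤ i.1 + 1 ∧ i.1 + 1 < rr (k + 1)) ↔ a i = k))
    (hb : ∀ i k, 1 ≤ k → k ≤ N → ((cc k ≤ i.1 + 1 ∧ i.1 + 1 < cc (k + 1)) ↔ b i = k))
    {k l : ℕ} (h1 : 1 ≤ k) (h2 : k ≤ N) (h3 : 1 ≤ l) (h4 : l ≤ N) (p : Fin R × Fin C) :
    p ∈ block rr cc k l ↔ a p.1 = k ∧ b p.2 = l := by
  rw [← ha p.1 k h1 h2, ← hb p.2 l h3 h4, block]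
  simp only [Finset.mem_filter, Finset.mem_univ, true_and, and_assoc]

theorem mem_Sdiag_iff {R C N : ℕ} {rr cc : ℕ → ℕ} {a : Fin R → ℕ} {b : Fin C → ℕ}
    (ha : ∀ i k, 1 ≤ k → k ≤ N → ((rr k ≤ i.1 + 1 ∧ i.1 + 1 < rr (k + 1)) ↔ a i = k))
    (hb : ∀ i k, 1 ≤ k → k ≤ N → ((cc k ≤ i.1 + 1 ∧ i.1 + 1 < cc (k + 1)) ↔ b i = k))
    (ha' : ∀ i, 1 ≤ a i ∧ a i ≤ N) (p : Fin R × Fin C) :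
    p ∈ Sdiag N rr cc ↔ a p.1 = b p.2 := by
  simp only [Sdiag, Finset.mem_biUnion, Finset.mem_Icc]
  constructor
  · rintro ⟨k, ⟨h1, h2⟩, h⟩
    rw [mem_block_iff ha hb h1 h2 h1 h2] at h
    omega
  · intro h
    have := ha' p.1
    exact ⟨a p.1, this, (mem_block_iff ha hb this.1 this.2 this.1 this.2 p).2 ⟨rfl, h.symm⟩⟩

theorem not_sameBlock {R C N : ℕ} {rr cc : ℕ → ℕ} {a : Fin R → ℕ} {b : Fin C → ℕ}
    (ha : ∀ i k, 1 ≤ k → k ≤ N → ((rr k ≤ i.1 + 1 ∧ i.1 + 1 < rr (k + 1)) ↔ a i = k))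
    (hb : ∀ i k, 1 ≤ k → k ≤ N → ((cc k ≤ i.1 + 1 ∧ i.1 + 1 < cc (k + 1)) ↔ b i = k))
    (p q : Fin R × Fin C) (h : a p.1 ≠ a q.1 ∨ b p.2 ≠ b q.2) :
    ¬ SameBlock N rr cc p q := by
  rintro ⟨k, l, h1, h2, h3, h4, h5, h6⟩
  rw [mem_block_iff ha hb h1 h2 h3 h4] at h5 h6
  omega

theorem typeIVrow_of {R C N : ℕ} {rr cc : ℕ → ℕ} {a : Fin R → ℕ} {b : Fin C → ℕ}
    (ha : ∀ i k, 1 ≤ k → k ≤ N → ((rr k ≤ i.1 + 1 ∧ i.1 + 1 < rr (k + 1)) ↔ a i = k))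
    (hb : ∀ i k, 1 ≤ k → k ≤ N → ((cc k ≤ i.1 + 1 ∧ i.1 + 1 < cc (k + 1)) ↔ b i = k))
    (ha' : ∀ i, 1 ≤ a i ∧ a i ≤ N)
    (i₁ i₂ i₃ i₄ : Fin R) (j₁ j₂ j₃ j₄ : Fin C)
    (g1 : a i₁ = b j₁) (g2 : a i₂ = b j₁) (g3 : a i₃ = b j₂) (g4 : a i₄ = b j₂)
    (g5 : b j₁ ≠ b j₂) (g6 : b j₃ ≠ b j₁) (g7 : b j₃ ≠ b j₂) (g8 : b j₄ ≠ b j₁)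
    (g9 : b j₄ ≠ b j₂) :
    IsTypeIVrow N N rr cc (e (i₁,j₁) + e (i₂,j₂) + e (i₃,j₃) + e (i₄,j₄)
        - e (i₁,j₃) - e (i₂,j₄) - e (i₃,j₂) - e (i₄,j₁)) := by
  have k1 := ha' i₁
  have k3 := ha' i₃
  refine ⟨i₁, i₂, i₃, i₄, j₁, j₂, j₃, j₄, rfl,
    ⟨a i₁, a i₃, k1.1, k1.2, k3.1, k3.2, by omega, ?_, ?_⟩, ?_, ?_, ?_⟩
  · rw [mem_block_iff ha hb k1.1 k1.2 k1.1 k1.2]; exact ⟨rfl, g1.symm⟩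
  · rw [mem_block_iff ha hb k3.1 k3.2 k3.1 k3.2]; exact ⟨rfl, g3.symm⟩
  · intro p hp
    rw [mem_Sdiag_iff ha hb ha']
    simp only [List.mem_cons, List.not_mem_nil, or_false] at hp
    rcases hp with rfl | rfl | rfl | rfl | rfl | rfl <;> simp only <;> omega
  · have q1 := (ha i₁ (a i₁) k1.1 k1.2).2 rfl
    have q2 := (ha i₂ (a i₁) k1.1 k1.2).2 (by omega)
    exact ⟨a i₁, k1.1, k1.2, q1.1, q1.2, q2.1, q2.2⟩
  · have q1 := (ha i₃ (a i₃) k3.1 k3.2).2 rfl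
    have q2 := (ha i₄ (a i₃) k3.1 k3.2).2 (by omega)
    exact ⟨a i₃, k3.1, k3.2, q1.1, q1.2, q2.1, q2.2⟩

theorem e_swap {R C : ℕ} (i : Fin R) (j : Fin C) (p : Fin C × Fin R) :
    e (i, j) (p.2, p.1) = e (j, i) p := by
  simp only [e, Prod.ext_iff, and_comm]

theorem goodRel {R C N : ℕ} {rr cc : ℕ → ℕ} {a : Fin R → ℕ} {b : Fin C → ℕ}
    (ha : ∀ i k, 1 ≤ k → k ≤ N → ((rr k ≤ i.1 + 1 ∧ i.1 + 1 < rr (k + 1)) ↔ a i = k))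
    (hb : ∀ i k, 1 ≤ k → k ≤ N → ((cc k ≤ i.1 + 1 ∧ i.1 + 1 < cc (k + 1)) ↔ b i = k))
    (ha' : ∀ i, 1 ≤ a i ∧ a i ≤ N) (hb' : ∀ i, 1 ≤ b i ∧ b i ≤ N)
    (B : Set (Table R C))
    (hB : B = {z | (IsBasicMove z ∨ IsTypeII N N rr cc z ∨ IsTypeIII N N rr cc z ∨
            IsTypeIV N N rr cc z) ∧
        IsMove (fun _ : Fin 1 => Sdiag (R := R) (C := C) N rr cc) z}) :
    GoodRel a b (Relation.ReflTransGen (fun s t => tab t - tab s ∈ B)) := by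
  have hS : ∀ p : Fin R × Fin C, p ∈ Sdiag N rr cc ↔ a p.1 = b p.2 := mem_Sdiag_iff ha hb ha'
  have hcnt : ∀ s : Multiset (Fin R × Fin C), s.countP (· ∈ Sdiag N rr cc) =
      s.countP (fun p => a p.1 = b p.2) := fun s => Multiset.countP_congr rfl (by simp [hS])
  have hmv : ∀ s t : Multiset (Fin R × Fin C),
      IsMove (fun _ : Fin 1 => Sdiag (R := R) (C := C) N rr cc) (tab t - tab s) ↔
      s.map Prod.fst = t.map Prod.fst ∧ s.map Prod.snd = t.map Prod.snd ∧
    s.countP (fun p => a p.1 = b p.2) = t.countP (fun p => a p.1 = b p.2) := by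
    intro s t
    rw [isMove_tab, hcnt, hcnt]
  have mk : ∀ s t : Multiset (Fin R × Fin C),
      (IsBasicMove (tab t - tab s) ∨ IsTypeII N N rr cc (tab t - tab s) ∨
        IsTypeIII N N rr cc (tab t - tab s) ∨ IsTypeIV N N rr cc (tab t - tab s)) →
      s.map Prod.fst = t.map Prod.fst → s.map Prod.snd = t.map Prod.snd →
      s.countP (fun p => a p.1 = b p.2) = t.countP (fun p => a p.1 = b p.2) →
      Relation.ReflTransGen (fun s t => tab t - tab s ∈ B) s t := by
    intro s t h h1 h2 h3
    refine Relation.ReflTransGen.single ?_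
    rw [hB]
    exact ⟨h, (hmv s t).2 ⟨h1, h2, h3⟩⟩
  have basic : ∀ i i' j j',
      (({(i, j), (i', j')} : Multiset (Fin R × Fin C)).countP (fun p => a p.1 = b p.2) =
        ({(i, j'), (i', j)} : Multiset (Fin R × Fin C)).countP (fun p => a p.1 = b p.2)) →
      Relation.ReflTransGen (fun s t => tab t - tab s ∈ B)
        ({(i, j), (i', j')} : Multiset (Fin R × Fin C)) {(i, j'), (i', j)} := by
    intro i i' j j' h
    by_cases h1 : i = i'
    · subst h1
      rw [Multiset.pair_comm]
    by_cases h2 : j = j'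
    · subst h2
      exact Relation.ReflTransGen.refl
    refine mk _ _ (Or.inl ⟨i, i', j', j, h1, Ne.symm h2, ?_⟩) (by simp)
      (by simp [Multiset.insert_eq_cons, Multiset.cons_swap j', ← Multiset.cons_zero]) h
    simp only [Multiset.insert_eq_cons, tab_cons, tab_singleton]; abel
  refine ⟨fun s => .refl, fun s t u h1 h2 => h1.trans h2, ?_, ?_, ?_, ?_, ?_, ?_, ?_, ?_, ?_⟩
  · intro s t u h
    induction h with
    | refl => exact .refl
    | tail _ h ih =>
      refine ih.tail ?_
      simpa only [tab_add, add_sub_add_right_eq_sub] using h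
  · intro s t h
    induction h with
    | refl => exact ⟨rfl, rfl, rfl⟩
    | tail _ h ih =>
      rw [hB] at h
      obtain ⟨h1, h2, h3⟩ := (hmv _ _).1 h.2
      exact ⟨ih.1.trans h1, ih.2.1.trans h2, ih.2.2.trans h3⟩
  · intro i i' j j' h
    apply basic
    simp only [Multiset.insert_eq_cons, ← Multiset.cons_zero, Multiset.countP_cons,
      Multiset.countP_zero, h]
    omega
  · intro i i' j j' h
    apply basic
    simp only [Multiset.insert_eq_cons, ← Multiset.cons_zero, Multiset.countP_cons,
      Multiset.countP_zero, h]
  · intro i i' j j' h1 h2 h3 h4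
    apply basic
    simp only [Multiset.insert_eq_cons, ← Multiset.cons_zero, Multiset.countP_cons,
      Multiset.countP_zero, h1, h2, h3, h4]
  · intro i₁ i₂ i₃ j₁ j₂ j₃ g1 g2 g3 g4 g5 g6 g7 g8 g9 g10 g11 g12
    refine mk _ _ (Or.inr (Or.inl ?_)) (by simp) ?_ ?_
    · have : IsTypeII N N rr cc (e (i₁,j₂) + e (i₂,j₃) + e (i₃,j₁) - e (i₁,j₃) - e (i₂,j₁)
          - e (i₃,j₂)) := by
        refine ⟨i₁, i₂, i₃, j₁, j₂, j₃, rfl, ?_, ?_⟩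
        · intro p hp
          rw [hS]
          simp only [List.mem_cons, List.not_mem_nil, or_false] at hp
          rcases hp with rfl | rfl | rfl | rfl | rfl | rfl <;> assumption
        · simp only [List.pairwise_cons, List.mem_cons, List.not_mem_nil, or_false,
            forall_eq_or_imp, forall_eq, IsEmpty.forall_iff, implies_true, and_true,
            List.Pairwise.nil]
          refine ⟨⟨?_, ?_, ?_, ?_, ?_⟩, ⟨?_, ?_, ?_, ?_⟩, ⟨?_, ?_, ?_⟩, ⟨?_, ?_⟩, ?_⟩ <;>
            exact not_sameBlock ha hb _ _ (by simp only; omega)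
      have := isTypeII_neg this
      convert this using 1
      simp only [Multiset.insert_eq_cons, tab_cons, tab_singleton]; abel
    · simp only [Multiset.insert_eq_cons, Multiset.map_add,
        Multiset.map_singleton, ← Multiset.singleton_add]
      abel
    · simp only [Multiset.insert_eq_cons, ← Multiset.cons_zero, Multiset.countP_cons,
        Multiset.countP_zero, g7, g8, g9, g10, g11, g12]
  · intro i₁ i₂ i₃ j₁ j₂ j₃ g1 g2 g3 g4 g5 g6 g7
    refine mk _ _ (Or.inr (Or.inr (Or.inl ?_))) (by simp) ?_ ?_
    · have : IsTypeIII N N rr cc (e (i₁,j₁) + e (i₂,j₃) + e (i₃,j₂) - e (i₁,j₃) - e (i₂,j₂)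
          - e (i₃,j₁)) := by
        have k1 := ha' i₁
        have k2 := ha' i₂
        refine ⟨i₁, i₂, i₃, j₁, j₂, j₃, rfl,
          ⟨a i₁, a i₂, k1.1, k1.2, k2.1, k2.2, g3, ?_, ?_⟩, ?_, ?_⟩
        · rw [mem_block_iff ha hb k1.1 k1.2 k1.1 k1.2]; exact ⟨rfl, g1.symm⟩
        · rw [mem_block_iff ha hb k2.1 k2.2 k2.1 k2.2]; exact ⟨rfl, g2.symm⟩
        · intro p hp
          rw [hS]
          simp only [List.mem_cons, List.not_mem_nil, or_false] at hp
          rcases hp with rfl | rfl | rfl | rfl <;> simp only <;> omega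
        · simp only [List.pairwise_cons, List.mem_cons, List.not_mem_nil, or_false,
            forall_eq_or_imp, forall_eq, IsEmpty.forall_iff, implies_true, and_true,
            List.Pairwise.nil]
          refine ⟨⟨?_, ?_, ?_⟩, ⟨?_, ?_⟩, ?_⟩ <;>
            exact not_sameBlock ha hb _ _ (by simp only; omega)
      have := isTypeIII_neg this
      convert this using 1
      simp only [Multiset.insert_eq_cons, tab_cons, tab_singleton]; abel
    · simp only [Multiset.insert_eq_cons, Multiset.map_add,
        Multiset.map_singleton, ← Multiset.singleton_add]
      abel
    · simp only [Multiset.insert_eq_cons, ← Multiset.cons_zero, Multiset.countP_cons,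
        Multiset.countP_zero]
      split_ifs <;> omega
  · intro r₁ r₂ r₃ r₄ c₁ c₂ c₃ c₄ g1 g2 g3 g4 g5 g6 g7 g8 g9
    refine mk _ _ (Or.inr (Or.inr (Or.inr (Or.inl ?_)))) (by simp) ?_ ?_
    · have := isTypeIVrow_neg
        (typeIVrow_of ha hb ha' r₁ r₂ r₃ r₄ c₁ c₂ c₃ c₄ g1 g2 g3 g4 g5 g6 g7 g8 g9)
      convert this using 1
      simp only [Multiset.insert_eq_cons, tab_cons, tab_singleton]; abel
    · simp only [Multiset.insert_eq_cons, Multiset.map_add,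
        Multiset.map_singleton, ← Multiset.singleton_add]
      abel
    · simp only [Multiset.insert_eq_cons, ← Multiset.cons_zero, Multiset.countP_cons,
        Multiset.countP_zero]
      split_ifs <;> omega
  · intro r₁ r₂ r₃ r₄ c₁ c₂ c₃ c₄ g1 g2 g3 g4 g5 g6 g7 g8 g9
    refine mk _ _ (Or.inr (Or.inr (Or.inr (Or.inr ?_)))) ?_ ?_ ?_
    · have := isTypeIVrow_neg
        (typeIVrow_of hb ha hb' c₁ c₂ c₃ c₄ r₁ r₂ r₃ r₄ g1 g2 g3 g4 g5 g6 g7 g8 g9)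
      convert this using 1
      funext p
      simp only [Multiset.insert_eq_cons, tab_cons, tab_singleton, Pi.add_apply, Pi.sub_apply,
        Pi.neg_apply, e_swap]
      abel
    · simp only [Multiset.insert_eq_cons, Multiset.map_add,
        Multiset.map_singleton, ← Multiset.singleton_add]
      abel
    · simp only [Multiset.insert_eq_cons, Multiset.map_add,
        Multiset.map_singleton, ← Multiset.singleton_add]
    · simp only [Multiset.insert_eq_cons, ← Multiset.cons_zero, Multiset.countP_cons,
        Multiset.countP_zero]
      split_ifs <;> omega

/-- for `N ≥ 3`, the moves of Types I–IV in `M_S` form a Markov basis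
for the configuration `A_S` of the common block diagonal effect model. -/
theorem commonBlockDiagonal_markovBasis (R C N : ℕ) (hN : 3 ≤ N)
    (rr cc : ℕ → ℕ) (hr1 : rr 1 = 1) (hc1 : cc 1 = 1)
    (hrmono : ∀ n, 1 ≤ n → n ≤ N → rr n < rr (n + 1))
    (hcmono : ∀ n, 1 ≤ n → n ≤ N → cc n < cc (n + 1))
    (hrtop : rr (N + 1) = R + 1) (hctop : cc (N + 1) = C + 1) :
    IsMarkovBasis (fun _ : Fin 1 => Sdiag (R := R) (C := C) N rr cc)
      {z | (IsBasicMove z ∨ IsTypeII N N rr cc z ∨ IsTypeIII N N rr cc z ∨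
            IsTypeIV N N rr cc z) ∧
        IsMove (fun _ : Fin 1 => Sdiag (R := R) (C := C) N rr cc) z} := by
  obtain ⟨a, ha', ha⟩ := exists_class R N rr hr1 hrmono hrtop
  obtain ⟨b, hb', hb⟩ := exists_class C N cc hc1 hcmono hctop
  have G := goodRel ha hb ha' hb' _ rfl
  refine ⟨moves_finite rr cc _, fun z hz => hz.2, ?_, ?_⟩
  · rintro z ⟨hz, hm⟩
    refine ⟨?_, ?_⟩
    · rcases hz with h | h | h | h
      · exact Or.inl (isBasicMove_neg h)
      · exact Or.inr (Or.inl (isTypeII_neg h))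
      · exact Or.inr (Or.inr (Or.inl (isTypeIII_neg h)))
      · exact Or.inr (Or.inr (Or.inr (isTypeIV_neg h)))
    · have h0 : configMap (fun _ : Fin 1 => Sdiag (R := R) (C := C) N rr cc) z = 0 := hm
      have h1 := configMap_sub (fun _ : Fin 1 => Sdiag (R := R) (C := C) N rr cc) (z - z) z
      rw [configMap_sub _ z z, h0, sub_self, sub_self, zero_sub] at h1
      exact h1
  · rintro t x ⟨hx, hxt⟩ y ⟨hy, hyt⟩ hxy
    obtain ⟨s, rfl⟩ := exists_tab x hx
    obtain ⟨s', rfl⟩ := exists_tab y hy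
    obtain ⟨h1, h2, h3⟩ := (configMap_tab_eq _ s s').1 (hxt.trans hyt.symm)
    have hcnt : ∀ s : Multiset (Fin R × Fin C), s.countP (· ∈ Sdiag N rr cc) =
      s.countP (fun p => a p.1 = b p.2) :=
        fun s => Multiset.countP_congr rfl (by simp [mem_Sdiag_iff ha hb ha'])
    rw [hcnt, hcnt] at h3
    obtain ⟨U, zs, k1, k2, -, k4⟩ := path_of_rel (Sdiag (R := R) (C := C) N rr cc) _
      (fun z hz => hz.2) s s' (G.conn _ s s' rfl h1 h2 h3)
    rw [hxt] at k4
    refine ⟨U, ?_, zs, k1, k2, k4⟩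
    rcases Nat.eq_zero_or_pos U with h | h
    · subst h
      exact absurd (by simpa using k2.symm) hxy
    · exact h

end Paper
end

section
/- Let N ≥ 3 and let S = I_{11} ∪ ⋯ ∪ I_{NN}. Suppose x ≠ y lie in the same fiber F_t of A_S, put z = x − y, and assume that for every block I_{kl} (1 ≤ k,l ≤ N) either z(I_{kl}) ≥ 0 or z(I_{kl}) ≤ 0 holds. If z(S) = 0 (z vanishes identically on S), then ‖z‖_1 can be reduced by a move of Type I or Type II belonging to M_S. -/
open Finset

namespace Paper

theorem exists_idx (N R : ℕ) (rr : ℕ → ℕ) (hr1 : rr 1 = 1) (m : ℕ) (hm : 1 ≤ m) :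
    ∀ n, n ≤ N → m < rr (n + 1) → ∃ k, 1 ≤ k ∧ k ≤ N ∧ rr k ≤ m ∧ m < rr (k + 1) := by
  intro n
  induction n with
  | zero => intro _ h; simp only [zero_add] at h; omega
  | succ n ih =>
    intro hn h
    by_cases h' : m < rr (n + 1)
    · exact ih (by omega) h'
    · exact ⟨n + 1, by omega, hn, by omega, h⟩

theorem rr_mono (N : ℕ) (rr : ℕ → ℕ) (hrmono : ∀ n, 1 ≤ n → n ≤ N → rr n < rr (n + 1))
    (k : ℕ) (hk : 1 ≤ k) : ∀ k', k ≤ k' → k' ≤ N → rr k ≤ rr k' := by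
  intro k' h
  induction k', h using Nat.le_induction with
  | base => intro _; exact le_rfl
  | succ n hn ih =>
    intro h
    have := ih (by omega)
    have := hrmono n (by omega) (by omega)
    omega

theorem idx_unique (N : ℕ) (rr : ℕ → ℕ) (hrmono : ∀ n, 1 ≤ n → n ≤ N → rr n < rr (n + 1))
    (m k k' : ℕ) (hk : 1 ≤ k) (hkN : k ≤ N) (hk' : 1 ≤ k') (hkN' : k' ≤ N)
    (h1 : rr k ≤ m) (h2 : m < rr (k + 1)) (h1' : rr k' ≤ m) (h2' : m < rr (k' + 1)) :
    k = k' := by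
  rcases lt_trichotomy k k' with h | h | h
  · have := rr_mono N rr hrmono (k + 1) (by omega) k' (by omega) hkN'
    omega
  · exact h
  · have := rr_mono N rr hrmono (k' + 1) (by omega) k (by omega) hkN
    omega

theorem l1_dec {R C : ℕ} (z : Table R C) (a : Fin R × Fin C) (h : 0 < z a) :
    l1 (z - e a) = l1 z - 1 := by
  unfold l1
  rw [eq_sub_iff_add_eq, ← Finset.add_sum_erase _ _ (Finset.mem_univ a),
    ← Finset.add_sum_erase _ (fun p => |z p|) (Finset.mem_univ a)]
  have : ∑ p ∈ univ.erase a, |(z - e a) p| = ∑ p ∈ univ.erase a, |z p| := by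
    apply Finset.sum_congr rfl
    intro p hp
    simp [e, Finset.ne_of_mem_erase hp]
  rw [this]
  simp only [Pi.sub_apply, e, if_true]
  rw [abs_of_pos h, abs_of_nonneg (by omega)]
  ring

theorem l1_neg {R C : ℕ} (z : Table R C) : l1 (-z) = l1 z := by
  simp [l1]

theorem l1_inc {R C : ℕ} (z : Table R C) (a : Fin R × Fin C) (h : z a < 0) :
    l1 (z + e a) = l1 z - 1 := by
  rw [← l1_neg, ← l1_neg z, ← l1_dec (-z) a (by simpa using h)]
  congr 1
  abel

theorem l1_e {R C : ℕ} (a : Fin R × Fin C) : l1 (e a) = 1 := by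
  simp [l1, e, apply_ite abs]

theorem l1_add_e {R C : ℕ} (z : Table R C) (a : Fin R × Fin C) :
    l1 (z + e a) ≤ l1 z + 1 := by
  rw [← l1_e a]
  unfold l1
  rw [← Finset.sum_add_distrib]
  exact Finset.sum_le_sum fun p _ => abs_add_le _ _

theorem config_add {R C N : ℕ} (S : Fin N → Finset (Fin R × Fin C)) (z w : Table R C) :
    configMap S (z + w) = configMap S z + configMap S w := by
  simp [configMap, Finset.sum_add_distrib, Prod.ext_iff, funext_iff]

theorem config_sub {R C N : ℕ} (S : Fin N → Finset (Fin R × Fin C)) (z w : Table R C) :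
    configMap S (z - w) = configMap S z - configMap S w := by
  simp [configMap, Prod.ext_iff, funext_iff]

theorem config_e {R C N : ℕ} (S : Fin N → Finset (Fin R × Fin C)) (a : Fin R) (b : Fin C)
    (h : ∀ n, (a, b) ∉ S n) :
    configMap S (e (a, b)) = (Pi.single a 1, Pi.single b 1, 0) := by
  simp only [configMap, e, Prod.mk.injEq]
  refine ⟨?_, ?_, ?_⟩
  · funext i
    by_cases hi : i = a <;> simp [hi, Pi.single_apply]
  · funext j
    by_cases hj : j = b <;> simp [hj, Pi.single_apply]
  · funext n
    simp [h n]

theorem reduce_x {R C : ℕ} (S : Fin 1 → Finset (Fin R × Fin C))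
    (t : (Fin R → ℤ) × (Fin C → ℤ) × (Fin 1 → ℤ)) (P : Table R C → Prop) (x y B : Table R C)
    (hx : x ∈ Fiber S t) (hP : P B) (hB : IsMove S B) (hn : ∀ p, 0 ≤ x p + B p)
    (hl : l1 (x - y + B) < l1 (x - y)) :
    CanReduce (Fiber S t) {z | P z ∧ IsMove S z} x y := by
  refine ⟨1, 0, by omega, fun _ => B, fun _ => 0, fun _ => ⟨hP, hB⟩, fun s => s.elim0, ?_,
    fun s => s.elim0, by simpa using hl⟩
  intro u
  have : (Finset.Iic u) = {0} := by
    ext v; simp [Subsingleton.elim v 0, Subsingleton.elim u 0]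
  rw [this, Finset.sum_singleton]
  refine ⟨hn, ?_⟩
  rw [config_add, hx.2, show configMap S B = 0 from hB, add_zero]

theorem reduce_y {R C : ℕ} (S : Fin 1 → Finset (Fin R × Fin C))
    (t : (Fin R → ℤ) × (Fin C → ℤ) × (Fin 1 → ℤ)) (P : Table R C → Prop) (x y B : Table R C)
    (hy : y ∈ Fiber S t) (hP : P B) (hB : IsMove S B) (hn : ∀ p, 0 ≤ y p - B p)
    (hl : l1 (x - y + B) < l1 (x - y)) :
    CanReduce (Fiber S t) {z | P z ∧ IsMove S z} x y := by
  refine ⟨0, 1, by omega, fun _ => 0, fun _ => B, fun s => s.elim0, fun _ => ⟨hP, hB⟩,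
    fun s => s.elim0, ?_, by simpa using hl⟩
  intro u
  have : (Finset.Iic u) = {0} := by
    ext v; simp [Subsingleton.elim v 0, Subsingleton.elim u 0]
  rw [this, Finset.sum_singleton]
  refine ⟨hn, ?_⟩
  rw [config_sub, hy.2, show configMap S B = 0 from hB, sub_zero]

theorem basic_isMove {R C N : ℕ} (S : Fin N → Finset (Fin R × Fin C)) (i i' : Fin R)
    (j j' : Fin C) (h1 : ∀ n, (i, j) ∉ S n) (h2 : ∀ n, (i', j') ∉ S n)
    (h3 : ∀ n, (i', j) ∉ S n) (h4 : ∀ n, (i, j') ∉ S n) :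
    IsMove S (e (i, j) + e (i', j') - e (i', j) - e (i, j')) := by
  unfold IsMove
  rw [config_sub, config_sub, config_add, config_e S _ _ h1, config_e S _ _ h2,
    config_e S _ _ h3, config_e S _ _ h4]
  simp only [Prod.mk_add_mk, Prod.mk_sub_mk, Prod.mk_eq_zero]
  refine ⟨?_, ?_, ?_⟩ <;> abel

/-- the `+ - +` case -/
theorem typeI_pos {R C : ℕ} (S : Fin 1 → Finset (Fin R × Fin C))
    (t : (Fin R → ℤ) × (Fin C → ℤ) × (Fin 1 → ℤ)) (Q : Table R C → Prop) (x y : Table R C)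
    (hx : x ∈ Fiber S t) (hy : y ∈ Fiber S t)
    (hS : ∀ n, ∀ p ∈ S n, x p - y p = 0) (i i' : Fin R) (j j' : Fin C)
    (h1 : 0 < x (i, j) - y (i, j)) (h2 : x (i, j') - y (i, j') < 0)
    (h3 : 0 < x (i', j') - y (i', j')) (h4 : ∀ n, (i', j) ∉ S n) :
    CanReduce (Fiber S t) {z | (IsBasicMove z ∨ Q z) ∧ IsMove S z} x y := by
  have hii : i' ≠ i := by rintro rfl; omega
  have hjj : j ≠ j' := by rintro rfl; omega
  have n1 := hy.1 (i, j)
  have n3 := hy.1 (i', j')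
  apply reduce_x S t (fun z => IsBasicMove z ∨ Q z) x y
    (e (i', j) + e (i, j') - e (i, j) - e (i', j')) hx
  · exact Or.inl ⟨i', i, j, j', hii, hjj, rfl⟩
  · apply basic_isMove S
    · exact h4
    · intro n h; have := hS n _ h; omega
    · intro n h; have := hS n _ h; omega
    · intro n h; have := hS n _ h; omega
  · intro p
    have := hx.1 p
    simp only [Pi.add_apply, Pi.sub_apply, e]
    by_cases a1 : p = (i, j)
    · subst a1; simp [hii, hii.symm, hjj, hjj.symm]; omega
    · by_cases a2 : p = (i', j')
      · subst a2; simp [hii, hii.symm, hjj, hjj.symm]; omega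
      · simp only [a1, a2, if_false]; split_ifs <;> omega
  · have e1 := l1_dec (x - y) (i, j) h1
    have e2 := l1_inc (x - y - e (i, j)) (i, j') (by simpa [e, hjj.symm] using h2)
    have e3 := l1_dec (x - y - e (i, j) + e (i, j')) (i', j') (by simpa [e, hii] using h3)
    have e4 := l1_add_e (x - y - e (i, j) + e (i, j') - e (i', j')) (i', j)
    have : x - y + (e (i', j) + e (i, j') - e (i, j) - e (i', j'))
      = x - y - e (i, j) + e (i, j') - e (i', j') + e (i', j) := by abel
    rw [this]; omega

theorem l1_sub_e {R C : ℕ} (z : Table R C) (a : Fin R × Fin C) :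
    l1 (z - e a) ≤ l1 z + 1 := by
  have := l1_add_e (-z) a
  rw [← l1_neg, l1_neg z, neg_add, neg_neg, ← sub_eq_add_neg] at this
  exact this

/-- the `- + -` case -/
theorem typeI_neg {R C : ℕ} (S : Fin 1 → Finset (Fin R × Fin C))
    (t : (Fin R → ℤ) × (Fin C → ℤ) × (Fin 1 → ℤ)) (Q : Table R C → Prop) (x y : Table R C)
    (hx : x ∈ Fiber S t) (hy : y ∈ Fiber S t)
    (hS : ∀ n, ∀ p ∈ S n, x p - y p = 0) (i i' : Fin R) (j j' : Fin C)
    (h1 : x (i, j) - y (i, j) < 0) (h2 : 0 < x (i, j') - y (i, j'))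
    (h3 : x (i', j') - y (i', j') < 0) (h4 : ∀ n, (i', j) ∉ S n) :
    CanReduce (Fiber S t) {z | (IsBasicMove z ∨ Q z) ∧ IsMove S z} x y := by
  have hii : i' ≠ i := by rintro rfl; omega
  have hjj : j ≠ j' := by rintro rfl; omega
  have n1 := hx.1 (i, j)
  have n3 := hx.1 (i', j')
  apply reduce_y S t (fun z => IsBasicMove z ∨ Q z) x y
    (e (i, j) + e (i', j') - e (i', j) - e (i, j')) hy
  · exact Or.inl ⟨i, i', j, j', hii.symm, hjj, rfl⟩
  · apply basic_isMove S
    · intro n h; have := hS n _ h; omega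
    · intro n h; have := hS n _ h; omega
    · exact h4
    · intro n h; have := hS n _ h; omega
  · intro p
    have := hy.1 p
    simp only [Pi.add_apply, Pi.sub_apply, e]
    by_cases a1 : p = (i, j)
    · subst a1; simp [hii, hii.symm, hjj, hjj.symm]; omega
    · by_cases a2 : p = (i', j')
      · subst a2; simp [hii, hii.symm, hjj, hjj.symm]; omega
      · simp only [a1, a2, if_false]; split_ifs <;> omega
  · have e1 := l1_inc (x - y) (i, j) h1
    have e2 := l1_dec (x - y + e (i, j)) (i, j') (by simpa [e, hjj.symm] using h2)
    have e3 := l1_inc (x - y + e (i, j) - e (i, j')) (i', j') (by simpa [e, hii] using h3)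
    have e4 := l1_sub_e (x - y + e (i, j) - e (i, j') + e (i', j')) (i', j)
    have : x - y + (e (i, j) + e (i', j') - e (i', j) - e (i, j'))
      = x - y + e (i, j) - e (i, j') + e (i', j') - e (i', j) := by abel
    rw [this]; omega

theorem typeII_red {R C : ℕ} (S : Fin 1 → Finset (Fin R × Fin C))
    (t : (Fin R → ℤ) × (Fin C → ℤ) × (Fin 1 → ℤ)) (P : Table R C → Prop) (x y : Table R C)
    (hx : x ∈ Fiber S t) (hy : y ∈ Fiber S t)
    (i1 i2 i3 : Fin R) (j1 j2 j3 : Fin C)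
    (hi12 : i1 ≠ i2) (hi13 : i1 ≠ i3) (hi23 : i2 ≠ i3)
    (hj12 : j1 ≠ j2) (hj13 : j1 ≠ j3) (hj23 : j2 ≠ j3)
    (h1 : x (i1, j2) - y (i1, j2) < 0) (h2 : x (i3, j1) - y (i3, j1) < 0)
    (h3 : 0 < x (i1, j3) - y (i1, j3)) (h4 : 0 < x (i2, j1) - y (i2, j1))
    (h5 : 0 < x (i3, j2) - y (i3, j2))
    (s1 : ∀ n, (i1, j2) ∉ S n) (s2 : ∀ n, (i2, j3) ∉ S n) (s3 : ∀ n, (i3, j1) ∉ S n)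
    (s4 : ∀ n, (i1, j3) ∉ S n) (s5 : ∀ n, (i2, j1) ∉ S n) (s6 : ∀ n, (i3, j2) ∉ S n)
    (hP : P (e (i1,j2) + e (i2,j3) + e (i3,j1) - e (i1,j3) - e (i2,j1) - e (i3,j2))) :
    CanReduce (Fiber S t) {z | P z ∧ IsMove S z} x y := by
  have n3 := hy.1 (i1, j3)
  have n4 := hy.1 (i2, j1)
  have n5 := hy.1 (i3, j2)
  apply reduce_x S t P x y _ hx hP
  · unfold IsMove
    rw [config_sub, config_sub, config_sub, config_add, config_add, config_e S _ _ s1,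
      config_e S _ _ s2, config_e S _ _ s3, config_e S _ _ s4, config_e S _ _ s5,
      config_e S _ _ s6]
    simp only [Prod.mk_add_mk, Prod.mk_sub_mk, Prod.mk_eq_zero]
    refine ⟨?_, ?_, ?_⟩ <;> abel
  · intro p
    have := hx.1 p
    simp only [Pi.add_apply, Pi.sub_apply, e]
    by_cases a1 : p = (i1, j3)
    · subst a1; simp [hi12, hi13, hj23.symm]; omega
    · by_cases a2 : p = (i2, j1)
      · subst a2; simp [hi12.symm, hi23, hj13]; omega
      · by_cases a3 : p = (i3, j2)
        · subst a3; simp [hi13.symm, hi23.symm, hj12.symm]; omega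
        · simp only [a1, a2, a3, if_false]; split_ifs <;> omega
  · have e1 := l1_inc (x - y) (i1, j2) h1
    have e2 := l1_inc (x - y + e (i1, j2)) (i3, j1) (by simpa [e, hi13.symm] using h2)
    have e3 := l1_dec (x - y + e (i1, j2) + e (i3, j1)) (i1, j3)
      (by simpa [e, hi13, hj23.symm] using h3)
    have e4 := l1_dec (x - y + e (i1, j2) + e (i3, j1) - e (i1, j3)) (i2, j1)
      (by simpa [e, hi12.symm, hi23] using h4)
    have e5 := l1_dec (x - y + e (i1, j2) + e (i3, j1) - e (i1, j3) - e (i2, j1)) (i3, j2)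
      (by simpa [e, hi13.symm, hi23.symm, hj12.symm] using h5)
    have e6 := l1_add_e
      (x - y + e (i1, j2) + e (i3, j1) - e (i1, j3) - e (i2, j1) - e (i3, j2)) (i2, j3)
    have : x - y + (e (i1,j2) + e (i2,j3) + e (i3,j1) - e (i1,j3) - e (i2,j1) - e (i3,j2))
      = x - y + e (i1, j2) + e (i3, j1) - e (i1, j3) - e (i2, j1) - e (i3, j2) + e (i2, j3) := by
      abel
    rw [this]; omega

theorem exists_pos {n : ℕ} (f : Fin n → ℤ) (h : ∑ i, f i = 0) (i : Fin n) (hi : f i < 0) :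
    ∃ k, 0 < f k := by
  by_contra! hc
  have := Finset.sum_lt_sum (s := univ) (f := f) (g := fun _ => 0) (fun k _ => hc k)
    ⟨i, mem_univ i, hi⟩
  simp [h] at this

theorem exists_neg {n : ℕ} (f : Fin n → ℤ) (h : ∑ i, f i = 0) (i : Fin n) (hi : 0 < f i) :
    ∃ k, f k < 0 := by
  obtain ⟨k, hk⟩ := exists_pos (fun i => - f i) (by simp [h]) i (by simpa using hi)
  exact ⟨k, by simpa using hk⟩

/-- if `z = x − y` is sign-constant on every block and vanishes on `S`,
then `‖z‖₁` can be reduced by a move of Type I or II in `M_S`. -/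
theorem blockDiagonal_reduce_typeI_II_of_Szero (R C N : ℕ) (hN : 3 ≤ N)
    (rr cc : ℕ → ℕ) (hr1 : rr 1 = 1) (hc1 : cc 1 = 1)
    (hrmono : ∀ n, 1 ≤ n → n ≤ N → rr n < rr (n + 1))
    (hcmono : ∀ n, 1 ≤ n → n ≤ N → cc n < cc (n + 1))
    (hrtop : rr (N + 1) = R + 1) (hctop : cc (N + 1) = C + 1)
    (t : (Fin R → ℤ) × (Fin C → ℤ) × (Fin 1 → ℤ))
    (x y : Table R C)
    (hx : x ∈ Fiber (fun _ : Fin 1 => Sdiag (R := R) (C := C) N rr cc) t)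
    (hy : y ∈ Fiber (fun _ : Fin 1 => Sdiag (R := R) (C := C) N rr cc) t)
    (hxy : x ≠ y)
    (hsign : ∀ k l, 1 ≤ k → k ≤ N → 1 ≤ l → l ≤ N →
      (∀ p ∈ block (R := R) (C := C) rr cc k l, 0 ≤ x p - y p) ∨
      (∀ p ∈ block (R := R) (C := C) rr cc k l, x p - y p ≤ 0))
    (hS : ∀ p ∈ Sdiag (R := R) (C := C) N rr cc, x p - y p = 0) :
    CanReduce (Fiber (fun _ : Fin 1 => Sdiag (R := R) (C := C) N rr cc) t)
      {z | (IsBasicMove z ∨ IsTypeII N N rr cc z) ∧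
        IsMove (fun _ : Fin 1 => Sdiag (R := R) (C := C) N rr cc) z}
      x y := by
  have hrow : ∀ i : Fin R, ∃ k, 1 ≤ k ∧ k ≤ N ∧ rr k ≤ i.1 + 1 ∧ i.1 + 1 < rr (k + 1) :=
    fun i => exists_idx N R rr hr1 (i.1 + 1) (by omega) N le_rfl (by have := i.2; omega)
  have hcol : ∀ j : Fin C, ∃ k, 1 ≤ k ∧ k ≤ N ∧ cc k ≤ j.1 + 1 ∧ j.1 + 1 < cc (k + 1) :=
    fun j => exists_idx N C cc hc1 (j.1 + 1) (by omega) N le_rfl (by have := j.2; omega)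
  choose ρ r1 r2 r3 r4 using hrow
  choose κ c1 c2 c3 c4 using hcol
  have hblk : ∀ i j, (i, j) ∈ block (R := R) (C := C) rr cc (ρ i) (κ j) := by
    intro i j
    simp only [block, mem_filter, mem_univ, true_and]
    exact ⟨r3 i, r4 i, c3 j, c4 j⟩
  have huniq : ∀ i j k l, 1 ≤ k → k ≤ N → 1 ≤ l → l ≤ N →
      (i, j) ∈ block (R := R) (C := C) rr cc k l → k = ρ i ∧ l = κ j := by
    intro i j k l hk hk' hl hl' h
    simp only [block, mem_filter, mem_univ, true_and] at h
    exact ⟨idx_unique N rr hrmono _ _ _ hk hk' (r1 i) (r2 i) h.1 h.2.1 (r3 i) (r4 i),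
      idx_unique N cc hcmono _ _ _ hl hl' (c1 j) (c2 j) h.2.2.1 h.2.2.2 (c3 j) (c4 j)⟩
  have hSd : ∀ i j, (i, j) ∈ Sdiag (R := R) (C := C) N rr cc ↔ ρ i = κ j := by
    intro i j
    simp only [Sdiag, mem_biUnion, mem_Icc]
    constructor
    · rintro ⟨k, ⟨hk, hk'⟩, h⟩
      have := huniq i j k k hk hk' hk hk' h
      omega
    · intro h
      refine ⟨ρ i, ⟨r1 i, r2 i⟩, ?_⟩
      have := hblk i j
      rwa [← h] at this
  have hSB : ∀ i j i' j', SameBlock (R := R) (C := C) N rr cc (i, j) (i', j') →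
      ρ i = ρ i' ∧ κ j = κ j' := by
    rintro i j i' j' ⟨k, l, hk, hk', hl, hl', h, h'⟩
    have h1 := huniq i j k l hk hk' hl hl' h
    have h2 := huniq i' j' k l hk hk' hl hl' h'
    omega
  have hrs : ∀ i, ∑ j, (x (i, j) - y (i, j)) = 0 := by
    intro i
    have h := congrFun (congrArg Prod.fst (hx.2.trans hy.2.symm)) i
    simp only [configMap] at h
    rw [Finset.sum_sub_distrib, h, sub_self]
  have hcs : ∀ j, ∑ i, (x (i, j) - y (i, j)) = 0 := by
    intro j
    have h := congrFun (congrArg (fun q => q.2.1) (hx.2.trans hy.2.symm)) j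
    simp only [configMap] at h
    rw [Finset.sum_sub_distrib, h, sub_self]
  have hz : ∀ i j, x (i, j) - y (i, j) ≠ 0 → ρ i ≠ κ j :=
    fun i j h h' => h (hS _ ((hSd i j).2 h'))
  obtain ⟨i, j1, j2, h1, h2⟩ : ∃ i j1 j2, 0 < x (i, j1) - y (i, j1) ∧
      x (i, j2) - y (i, j2) < 0 := by
    obtain ⟨⟨i, j⟩, hp⟩ := Function.ne_iff.1 hxy
    rcases lt_or_gt_of_ne hp with h | h
    · obtain ⟨j1, hj⟩ := exists_pos (fun j => x (i, j) - y (i, j)) (hrs i) j (by omega)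
      exact ⟨i, j1, j, hj, by omega⟩
    · obtain ⟨j1, hj⟩ := exists_neg (fun j => x (i, j) - y (i, j)) (hrs i) j (by omega)
      exact ⟨i, j, j1, by omega, hj⟩
  obtain ⟨i2, h3⟩ := exists_pos (fun i => x (i, j2) - y (i, j2)) (hcs j2) i h2
  obtain ⟨j3, h4⟩ := exists_neg (fun j => x (i2, j) - y (i2, j)) (hrs i2) j2 h3
  obtain ⟨i3, h5⟩ := exists_pos (fun i => x (i, j3) - y (i, j3)) (hcs j3) i2 h4
  have hS' : ∀ n : Fin 1, ∀ p ∈ (fun _ : Fin 1 => Sdiag (R := R) (C := C) N rr cc) n,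
      x p - y p = 0 := fun _ => hS
  by_cases g1 : ρ i2 = κ j1
  swap
  · exact typeI_pos _ t _ x y hx hy hS' i i2 j1 j2 h1 h2 h3 (fun _ h => g1 ((hSd _ _).1 h))
  by_cases g2 : ρ i = κ j3
  swap
  · exact typeI_neg _ t _ x y hx hy hS' i2 i j3 j2 h4 h3 h2 (fun _ h => g2 ((hSd _ _).1 h))
  by_cases g3 : ρ i3 = κ j2
  swap
  · exact typeI_pos _ t _ x y hx hy hS' i2 i3 j2 j3 h3 h4 h5 (fun _ h => g3 ((hSd _ _).1 h))
  have d1 : ρ i ≠ κ j1 := hz _ _ (by omega)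
  have d2 : ρ i ≠ κ j2 := hz _ _ (by omega)
  have d3 : κ j1 ≠ κ j2 := by
    intro h
    have hb1 := hblk i j1
    have hb2 := hblk i j2
    rw [← h] at hb2
    rcases hsign (ρ i) (κ j1) (r1 _) (r2 _) (c1 _) (c2 _) with hs | hs
    · have := hs _ hb2; omega
    · have := hs _ hb1; omega
  have nS : ∀ a b, ρ a ≠ κ b → (a, b) ∉ Sdiag (R := R) (C := C) N rr cc :=
    fun a b h h' => h ((hSd a b).1 h')
  have nB : ∀ a b a' b', (ρ a ≠ ρ a' ∨ κ b ≠ κ b') →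
      ¬ SameBlock (R := R) (C := C) N rr cc (a, b) (a', b') := by
    intro a b a' b' h h'
    have := hSB _ _ _ _ h'
    omega
  have nρ : ∀ a a', ρ a ≠ ρ a' → a ≠ a' := fun a a' h h' => h (by rw [h'])
  have nκ : ∀ a a', κ a ≠ κ a' → a ≠ a' := fun a a' h h' => h (by rw [h'])
  refine typeII_red _ t _ x y hx hy i i3 i2 j3 j2 j1 (nρ _ _ (by omega)) (nρ _ _ (by omega))
    (nρ _ _ (by omega)) (nκ _ _ (by omega)) (nκ _ _ (by omega)) (nκ _ _ (by omega))
    h2 h4 h1 h5 h3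
    (fun _ => nS _ _ (by omega)) (fun _ => nS _ _ (by omega)) (fun _ => nS _ _ (by omega))
    (fun _ => nS _ _ (by omega)) (fun _ => nS _ _ (by omega)) (fun _ => nS _ _ (by omega))
    (Or.inr ⟨i, i3, i2, j3, j2, j1, rfl, ?_, ?_⟩)
  · intro p hp
    simp only [List.mem_cons, List.not_mem_nil, or_false] at hp
    rcases hp with rfl | rfl | rfl | rfl | rfl | rfl <;> exact nS _ _ (by omega)
  · simp only [List.pairwise_cons, List.mem_cons, List.not_mem_nil, or_false, forall_eq_or_imp,
      forall_eq, List.Pairwise.nil, and_true, false_imp_iff, implies_true]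
    refine ⟨⟨?_, ?_, ?_, ?_, ?_⟩, ⟨?_, ?_, ?_, ?_⟩, ⟨?_, ?_, ?_⟩, ⟨?_, ?_⟩, ?_⟩ <;>
      exact nB _ _ _ _ (by omega)

end Paper
end

section
/- Let N ≥ 3 and let S = I_{11} ∪ ⋯ ∪ I_{NN}. Suppose x ≠ y lie in the same fiber F_t of A_S, put z = x − y, and assume that for every block I_{kl} either z(I_{kl}) ≥ 0 or z(I_{kl}) ≤ 0 holds. Suppose there are diagonal indices k, l with z(I_{kk}) > 0 and z(I_{ll}) < 0, and a cell (i,j) ∈ I_{kk} with z_{ij} > 0 such that z_{i′j} ≥ 0 for every i′ with r_l ≤ i′ < r_{l+1} and z_{ij′} ≥ 0 for every j′ with c_l ≤ j′ < c_{l+1}. Then ‖z‖_1 can be reduced by a move of Type III belonging to M_S. -/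
open Finset

namespace Paper

theorem aux_mono (N : ℕ) (rr : ℕ → ℕ) (h : ∀ n, 1 ≤ n → n ≤ N → rr n < rr (n + 1))
    (m d : ℕ) (hm : 1 ≤ m) (hd : m + d ≤ N + 1) : rr m ≤ rr (m + d) := by
  induction d with
  | zero => simp
  | succ d ih =>
    have h1 := ih (by omega)
    have h2 := h (m + d) (by omega) (by omega)
    have h3 : m + (d + 1) = m + d + 1 := by omega
    rw [h3]; omega

theorem aux_uniq (N : ℕ) (rr : ℕ → ℕ) (h : ∀ n, 1 ≤ n → n ≤ N → rr n < rr (n + 1))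
    (m m' v : ℕ) (hm : 1 ≤ m) (hmN : m ≤ N) (hm' : 1 ≤ m') (hmN' : m' ≤ N)
    (h1 : rr m ≤ v) (h2 : v < rr (m + 1)) (h3 : rr m' ≤ v) (h4 : v < rr (m' + 1)) :
    m = m' := by
  rcases lt_trichotomy m m' with hlt | heq | hlt
  · have := aux_mono N rr h (m + 1) (m' - (m + 1)) (by omega) (by omega)
    rw [show m + 1 + (m' - (m + 1)) = m' by omega] at this
    omega
  · exact heq
  · have := aux_mono N rr h (m' + 1) (m - (m' + 1)) (by omega) (by omega)
    rw [show m' + 1 + (m - (m' + 1)) = m by omega] at this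
    omega

theorem sum_e {R C : ℕ} (S : Finset (Fin R × Fin C)) (a : Fin R × Fin C) :
    ∑ p ∈ S, e a p = if a ∈ S then 1 else 0 := by
  simp [e]

theorem sum_e_row {R C : ℕ} (i i' : Fin R) (j' : Fin C) :
    ∑ j, e (i', j') (i, j) = if i = i' then 1 else 0 := by
  by_cases h : i = i' <;> simp [e, h]

theorem sum_e_col {R C : ℕ} (j : Fin C) (i' : Fin R) (j' : Fin C) :
    ∑ i, e (i', j') (i, j) = if j = j' then 1 else 0 := by
  by_cases h : j = j' <;> simp [e, h]

theorem l1_lt {R C : ℕ} (z : Table R C) (a b c d f g : Fin R × Fin C)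
    (hab : a ≠ b) (hac : a ≠ c) (had : a ≠ d) (hbc : b ≠ c) (hbd : b ≠ d) (hcd : c ≠ d)
    (ha : z a < 0) (hb : z b < 0) (hc : z c < 0) (hd : 0 < z d) :
    l1 (z + (e a + e b + e c - e f - e d - e g)) < l1 z := by
  have key : ∀ p, |(z + (e a + e b + e c - e f - e d - e g)) p| ≤
      |z p| - e a p - e b p - e c p - e d p + e f p + e g p := by
    intro p
    have h1 : ∀ q : Fin R × Fin C, 0 ≤ e q p := by
      intro q; unfold e; split_ifs <;> simp
    have hf := h1 f
    have hg := h1 g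
    have h2 : |z p + e a p + e b p + e c p - e d p| ≤
        |z p| - e a p - e b p - e c p - e d p := by
      by_cases pa : p = a
      · subst pa
        simp only [e, if_true, if_neg hab, if_neg hac, if_neg had]
        rw [abs_of_neg ha, abs_of_nonpos (by omega)]; omega
      by_cases pb : p = b
      · subst pb
        simp only [e, if_true, if_neg pa, if_neg hbc, if_neg hbd]
        rw [abs_of_neg hb, abs_of_nonpos (by omega)]; omega
      by_cases pc : p = c
      · subst pc
        simp only [e, if_true, if_neg pa, if_neg pb, if_neg hcd]
        rw [abs_of_neg hc, abs_of_nonpos (by omega)]; omega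
      by_cases pd : p = d
      · subst pd
        simp only [e, if_true, if_neg pa, if_neg pb, if_neg pc]
        rw [abs_of_pos hd, abs_of_nonneg (by omega)]; omega
      simp [e, pa, pb, pc, pd]
    simp only [Pi.add_apply, Pi.sub_apply]
    rw [abs_le] at h2 ⊢
    constructor <;> omega
  have hs := Finset.sum_le_sum (fun p (_ : p ∈ (Finset.univ : Finset (Fin R × Fin C))) => key p)
  simp only [Finset.sum_add_distrib, Finset.sum_sub_distrib, sum_e, Finset.mem_univ, if_true] at hs
  unfold l1
  omega

theorem nonneg_sub {R C : ℕ} (y : Table R C) (p a b c d f g : Fin R × Fin C)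
    (h0 : 0 ≤ y p) (ha : 1 ≤ y a) (hb : 1 ≤ y b) (hc : 1 ≤ y c)
    (hab : a ≠ b) (hac : a ≠ c) (hbc : b ≠ c) :
    0 ≤ (y - (e a + e b + e c - e d - e f - e g)) p := by
  have h1 : ∀ q : Fin R × Fin C, 0 ≤ e q p := by
    intro q; unfold e; split_ifs <;> simp
  have hd := h1 d
  have hf := h1 f
  have hg := h1 g
  have h2 : e a p + e b p + e c p ≤ y p := by
    by_cases pa : p = a
    · subst pa
      simp only [e, if_true, if_neg hab, if_neg hac]; omega
    by_cases pb : p = b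
    · subst pb
      simp only [e, if_true, if_neg pa, if_neg hbc]; omega
    by_cases pc : p = c
    · subst pc
      simp only [e, if_true, if_neg pa, if_neg pb]; omega
    simpa [e, pa, pb, pc] using h0
  simp only [Pi.add_apply, Pi.sub_apply]
  omega

set_option maxHeartbeats 2000000 in
/-- under block-wise sign constancy, if `z(I_{kk}) > 0`, `z(I_{ll}) < 0`
and the positive cell `(i,j) ∈ I_{kk}` sees no negative entry of `z` in the `l`-th row
block of column `j` nor in the `l`-th column block of row `i`, then `‖z‖₁` can be
reduced by a move of Type III in `M_S`. -/
theorem blockDiagonal_reduce_typeIII (R C N : ℕ) (hN : 3 ≤ N)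
    (rr cc : ℕ → ℕ) (hr1 : rr 1 = 1) (hc1 : cc 1 = 1)
    (hrmono : ∀ n, 1 ≤ n → n ≤ N → rr n < rr (n + 1))
    (hcmono : ∀ n, 1 ≤ n → n ≤ N → cc n < cc (n + 1))
    (hrtop : rr (N + 1) = R + 1) (hctop : cc (N + 1) = C + 1)
    (t : (Fin R → ℤ) × (Fin C → ℤ) × (Fin 1 → ℤ))
    (x y : Table R C)
    (hx : x ∈ Fiber (fun _ : Fin 1 => Sdiag (R := R) (C := C) N rr cc) t)
    (hy : y ∈ Fiber (fun _ : Fin 1 => Sdiag (R := R) (C := C) N rr cc) t)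
    (hxy : x ≠ y)
    (hsign : ∀ k l, 1 ≤ k → k ≤ N → 1 ≤ l → l ≤ N →
      (∀ p ∈ block (R := R) (C := C) rr cc k l, 0 ≤ x p - y p) ∨
      (∀ p ∈ block (R := R) (C := C) rr cc k l, x p - y p ≤ 0))
    (k l : ℕ) (hk1 : 1 ≤ k) (hkN : k ≤ N) (hl1 : 1 ≤ l) (hlN : l ≤ N)
    (hkk : ∃ p ∈ block (R := R) (C := C) rr cc k k, 0 < x p - y p)
    (hll : ∃ p ∈ block (R := R) (C := C) rr cc l l, x p - y p < 0)
    (i : Fin R) (j : Fin C)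
    (hij : (i, j) ∈ block (R := R) (C := C) rr cc k k)
    (hijpos : 0 < x (i, j) - y (i, j))
    (hrow : ∀ i' : Fin R, rr l ≤ i'.1 + 1 → i'.1 + 1 < rr (l + 1) →
      0 ≤ x (i', j) - y (i', j))
    (hcol : ∀ j' : Fin C, cc l ≤ j'.1 + 1 → j'.1 + 1 < cc (l + 1) →
      0 ≤ x (i, j') - y (i, j')) :
    CanReduce (Fiber (fun _ : Fin 1 => Sdiag (R := R) (C := C) N rr cc) t)
      {z | IsTypeIII N N rr cc z ∧
        IsMove (fun _ : Fin 1 => Sdiag (R := R) (C := C) N rr cc) z}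
      x y := by
  obtain ⟨hx0, hxt⟩ := hx
  obtain ⟨hy0, hyt⟩ := hy
  have hcfg : configMap (fun _ : Fin 1 => Sdiag (R := R) (C := C) N rr cc) x =
    configMap (fun _ : Fin 1 => Sdiag (R := R) (C := C) N rr cc) y := hxt.trans hyt.symm
  obtain ⟨⟨i₂, j₂⟩, hl2, hlneg⟩ := hll
  have hkpos : ∀ p ∈ block (R := R) (C := C) rr cc k k, 0 ≤ x p - y p := by
    rcases hsign k k hk1 hkN hk1 hkN with h | h
    · exact h
    · have := h _ hij
      omega
  have hkl : k ≠ l := by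
    rintro rfl
    have := hkpos _ hl2
    omega
  have hrs : ∑ j', (x (i, j') - y (i, j')) = 0 := by
    have := congrFun (congrArg Prod.fst hcfg) i
    simp only [configMap] at this
    rw [Finset.sum_sub_distrib, this, sub_self]
  have hcs : ∑ i', (x (i', j) - y (i', j)) = 0 := by
    have := congrFun (congrArg (fun t => t.2.1) hcfg) j
    simp only [configMap] at this
    rw [Finset.sum_sub_distrib, this, sub_self]
  obtain ⟨j₃, hj3⟩ : ∃ j₃, x (i, j₃) - y (i, j₃) < 0 := by
    by_contra! hcon
    have := Finset.single_le_sum (fun q _ => hcon q) (Finset.mem_univ j)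
    omega
  obtain ⟨i₃, hi3⟩ : ∃ i₃, x (i₃, j) - y (i₃, j) < 0 := by
    by_contra! hcon
    have := Finset.single_le_sum (f := fun i' => x (i', j) - y (i', j))
      (fun q _ => hcon q) (Finset.mem_univ i)
    omega
  simp only [block, Finset.mem_filter, Finset.mem_univ, true_and] at hij hl2
  obtain ⟨a1, a2, a3, a4⟩ := hij
  obtain ⟨b1, b2, b3, b4⟩ := hl2
  have ur := aux_uniq N rr hrmono
  have uc := aux_uniq N cc hcmono
  -- j₃ is in neither column block k nor l, and similarly for i₃
  have nj3k : ¬ (cc k ≤ j₃.1 + 1 ∧ j₃.1 + 1 < cc (k + 1)) := by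
    rintro ⟨h1, h2⟩
    have := hkpos (i, j₃) (Finset.mem_filter.2 ⟨Finset.mem_univ _, a1, a2, h1, h2⟩)
    omega
  have ni3k : ¬ (rr k ≤ i₃.1 + 1 ∧ i₃.1 + 1 < rr (k + 1)) := by
    rintro ⟨h1, h2⟩
    have := hkpos (i₃, j) (Finset.mem_filter.2 ⟨Finset.mem_univ _, h1, h2, a3, a4⟩)
    omega
  have nj3l : ¬ (cc l ≤ j₃.1 + 1 ∧ j₃.1 + 1 < cc (l + 1)) := by
    rintro ⟨h1, h2⟩
    have := hcol j₃ h1 h2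
    omega
  have ni3l : ¬ (rr l ≤ i₃.1 + 1 ∧ i₃.1 + 1 < rr (l + 1)) := by
    rintro ⟨h1, h2⟩
    have := hrow i₃ h1 h2
    omega
  have memS : ∀ p : Fin R × Fin C, p ∈ Sdiag N rr cc ↔ ∃ m, (1 ≤ m ∧ m ≤ N) ∧
      rr m ≤ p.1.1 + 1 ∧ p.1.1 + 1 < rr (m+1) ∧ cc m ≤ p.2.1 + 1 ∧ p.2.1 + 1 < cc (m+1) := by
    intro p
    simp [Sdiag, block]
  have s1 : (i₂, j₂) ∈ Sdiag N rr cc := (memS _).2 ⟨l, ⟨hl1, hlN⟩, b1, b2, b3, b4⟩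
  have s2 : (i, j) ∈ Sdiag N rr cc := (memS _).2 ⟨k, ⟨hk1, hkN⟩, a1, a2, a3, a4⟩
  have n1 : (i, j₃) ∉ Sdiag N rr cc := by
    rw [memS]
    rintro ⟨m, ⟨m1, m2⟩, c1, c2, c3, c4⟩
    obtain rfl := ur _ _ _ hk1 hkN m1 m2 a1 a2 c1 c2
    exact nj3k ⟨c3, c4⟩
  have n2 : (i₃, j₂) ∉ Sdiag N rr cc := by
    rw [memS]
    rintro ⟨m, ⟨m1, m2⟩, c1, c2, c3, c4⟩
    obtain rfl := uc _ _ _ hl1 hlN m1 m2 b3 b4 c3 c4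
    exact ni3l ⟨c1, c2⟩
  have n3 : (i₂, j₃) ∉ Sdiag N rr cc := by
    rw [memS]
    rintro ⟨m, ⟨m1, m2⟩, c1, c2, c3, c4⟩
    obtain rfl := ur _ _ _ hl1 hlN m1 m2 b1 b2 c1 c2
    exact nj3l ⟨c3, c4⟩
  have n4 : (i₃, j) ∉ Sdiag N rr cc := by
    rw [memS]
    rintro ⟨m, ⟨m1, m2⟩, c1, c2, c3, c4⟩
    obtain rfl := uc _ _ _ hk1 hkN m1 m2 a3 a4 c3 c4
    exact ni3k ⟨c1, c2⟩
  have dii2 : i ≠ i₂ := by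
    rintro rfl
    exact hkl (ur _ _ _ hk1 hkN hl1 hlN a1 a2 b1 b2)
  have djj2 : j ≠ j₂ := by
    rintro rfl
    exact hkl (uc _ _ _ hk1 hkN hl1 hlN a3 a4 b3 b4)
  have dii3 : i ≠ i₃ := by
    rintro rfl
    exact ni3k ⟨a1, a2⟩
  have djj3 : j ≠ j₃ := by
    rintro rfl
    exact nj3k ⟨a3, a4⟩
  have di2i3 : i₂ ≠ i₃ := by
    rintro rfl
    exact ni3l ⟨b1, b2⟩
  have dj2j3 : j₂ ≠ j₃ := by
    rintro rfl
    exact nj3l ⟨b3, b4⟩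
  set B : Table R C :=
    e (i₂,j₂) + e (i,j₃) + e (i₃,j) - e (i₂,j₃) - e (i,j) - e (i₃,j₂) with hB
  have hmove : IsMove (fun _ : Fin 1 => Sdiag (R := R) (C := C) N rr cc) B := by
    refine Prod.ext ?_ (Prod.ext ?_ ?_)
    · funext q
      simp only [configMap, hB, Pi.add_apply, Pi.sub_apply, Finset.sum_add_distrib,
        Finset.sum_sub_distrib, sum_e_row, Prod.fst_zero, Pi.zero_apply]
      ring
    · funext q
      simp only [configMap, hB, Pi.add_apply, Pi.sub_apply, Finset.sum_add_distrib,
        Finset.sum_sub_distrib, sum_e_col, Prod.fst_zero, Prod.snd_zero, Pi.zero_apply]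
      ring
    · funext q
      simp only [configMap, hB, Pi.add_apply, Pi.sub_apply, Finset.sum_add_distrib,
        Finset.sum_sub_distrib, sum_e, Prod.snd_zero, Pi.zero_apply, s1, s2, n1, n2, n3, n4,
        if_true, if_false]
      ring
  have htype : IsTypeIII N N rr cc B := by
    refine ⟨i₂, i, i₃, j₂, j, j₃, hB, ⟨l, k, hl1, hlN, hk1, hkN, hkl.symm, ?_, ?_⟩, ?_, ?_⟩
    · exact Finset.mem_filter.2 ⟨Finset.mem_univ _, b1, b2, b3, b4⟩
    · exact Finset.mem_filter.2 ⟨Finset.mem_univ _, a1, a2, a3, a4⟩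
    · intro p hp
      simp only [List.mem_cons, List.not_mem_nil, or_false] at hp
      rcases hp with rfl | rfl | rfl | rfl <;> assumption
    · have hsb : ∀ p q : Fin R × Fin C, SameBlock N rr cc p q → ∃ m n, (1 ≤ m ∧ m ≤ N) ∧
          (1 ≤ n ∧ n ≤ N) ∧
          (rr m ≤ p.1.1 + 1 ∧ p.1.1 + 1 < rr (m+1) ∧
            cc n ≤ p.2.1 + 1 ∧ p.2.1 + 1 < cc (n+1)) ∧
          (rr m ≤ q.1.1 + 1 ∧ q.1.1 + 1 < rr (m+1) ∧
            cc n ≤ q.2.1 + 1 ∧ q.2.1 + 1 < cc (n+1)) := by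
        rintro p q ⟨m, n, h1, h2, h3, h4, h5, h6⟩
        simp only [block, Finset.mem_filter, Finset.mem_univ, true_and] at h5 h6
        exact ⟨m, n, ⟨h1, h2⟩, ⟨h3, h4⟩, h5, h6⟩
      have t12 : ¬ SameBlock N rr cc (i, j₃) (i₃, j₂) := by
        intro h
        obtain ⟨m, n, ⟨m1, m2⟩, ⟨o1, o2⟩, ⟨c1, c2, c3, c4⟩, ⟨d1, d2, d3, d4⟩⟩ := hsb _ _ h
        obtain rfl := ur _ _ _ hk1 hkN m1 m2 a1 a2 c1 c2
        exact ni3k ⟨d1, d2⟩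
      have t13 : ¬ SameBlock N rr cc (i, j₃) (i₂, j₃) := by
        intro h
        obtain ⟨m, n, ⟨m1, m2⟩, ⟨o1, o2⟩, ⟨c1, c2, c3, c4⟩, ⟨d1, d2, d3, d4⟩⟩ := hsb _ _ h
        obtain rfl := ur _ _ _ hk1 hkN m1 m2 a1 a2 c1 c2
        exact hkl (ur _ _ _ hk1 hkN hl1 hlN d1 d2 b1 b2)
      have t14 : ¬ SameBlock N rr cc (i, j₃) (i₃, j) := by
        intro h
        obtain ⟨m, n, ⟨m1, m2⟩, ⟨o1, o2⟩, ⟨c1, c2, c3, c4⟩, ⟨d1, d2, d3, d4⟩⟩ := hsb _ _ h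
        obtain rfl := ur _ _ _ hk1 hkN m1 m2 a1 a2 c1 c2
        exact ni3k ⟨d1, d2⟩
      have t23 : ¬ SameBlock N rr cc (i₃, j₂) (i₂, j₃) := by
        intro h
        obtain ⟨m, n, ⟨m1, m2⟩, ⟨o1, o2⟩, ⟨c1, c2, c3, c4⟩, ⟨d1, d2, d3, d4⟩⟩ := hsb _ _ h
        obtain rfl := ur _ _ _ hl1 hlN m1 m2 b1 b2 d1 d2
        exact ni3l ⟨c1, c2⟩
      have t24 : ¬ SameBlock N rr cc (i₃, j₂) (i₃, j) := by
        intro h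
        obtain ⟨m, n, ⟨m1, m2⟩, ⟨o1, o2⟩, ⟨c1, c2, c3, c4⟩, ⟨d1, d2, d3, d4⟩⟩ := hsb _ _ h
        obtain rfl := uc _ _ _ hk1 hkN o1 o2 a3 a4 d3 d4
        exact hkl (uc _ _ _ hk1 hkN hl1 hlN c3 c4 b3 b4)
      have t34 : ¬ SameBlock N rr cc (i₂, j₃) (i₃, j) := by
        intro h
        obtain ⟨m, n, ⟨m1, m2⟩, ⟨o1, o2⟩, ⟨c1, c2, c3, c4⟩, ⟨d1, d2, d3, d4⟩⟩ := hsb _ _ h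
        obtain rfl := ur _ _ _ hl1 hlN m1 m2 b1 b2 c1 c2
        exact ni3l ⟨d1, d2⟩
      have sy : ∀ p q : Fin R × Fin C, SameBlock N rr cc p q → SameBlock N rr cc q p := by
        rintro p q ⟨m, n, h1, h2, h3, h4, h5, h6⟩
        exact ⟨m, n, h1, h2, h3, h4, h6, h5⟩
      have u1 := fun h => t34 (sy _ _ h)
      have u2 := fun h => t24 (sy _ _ h)
      have u3 := fun h => t23 (sy _ _ h)
      refine List.Pairwise.cons ?_ (List.Pairwise.cons ?_ (List.Pairwise.cons ?_
        (List.pairwise_singleton _ _)))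
      all_goals simp only [List.pairwise_cons, List.mem_cons, List.not_mem_nil, or_false, forall_eq_or_imp,
        forall_eq, not_false_eq_true, and_self, false_imp_iff,
        implies_true, List.Pairwise.nil]
      · exact ⟨t14, t13, t12⟩
      · exact ⟨u1, u2⟩
      · exact u3
  have hIic : ∀ u : Fin 1, ∑ s ∈ Finset.Iic u, (fun _ : Fin 1 => B) s = B := by
    intro u
    have : Finset.Iic u = {0} := by
      ext v; simp [Subsingleton.elim v u, Subsingleton.elim u 0]
    rw [this]; simp
  refine ⟨0, 1, by norm_num, fun _ => 0, fun _ => B, fun s => s.elim0,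
    fun _ => ⟨htype, hmove⟩, fun u => u.elim0, ?_, ?_⟩
  · intro u
    rw [hIic]
    refine ⟨?_, ?_⟩
    · intro p
      have h0 := hy0 p
      exact nonneg_sub y p _ _ _ _ _ _ h0 (by have := hx0 (i₂, j₂); omega)
        (by have := hx0 (i, j₃); omega) (by have := hx0 (i₃, j); omega)
        (fun h => dii2 (congrArg Prod.fst h).symm) (fun h => di2i3 (congrArg Prod.fst h))
        (fun h => dii3 (congrArg Prod.fst h))
    · rw [← hyt]
      have hm := hmove
      unfold IsMove at hm
      have hlin : configMap (fun _ : Fin 1 => Sdiag (R := R) (C := C) N rr cc) (y - B) =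
          configMap (fun _ : Fin 1 => Sdiag (R := R) (C := C) N rr cc) y -
          configMap (fun _ : Fin 1 => Sdiag (R := R) (C := C) N rr cc) B := by
        refine Prod.ext ?_ (Prod.ext ?_ ?_) <;> funext q <;>
          simp [configMap, Finset.sum_sub_distrib]
      rw [hlin, hm, sub_zero]
  · have := l1_lt (x - y) (i₂, j₂) (i, j₃) (i₃, j) (i, j) (i₂, j₃) (i₃, j₂)
      (by simp [dii2.symm]) (by simp [di2i3]) (by simp [dii2.symm]) (by simp [dii3])
      (by simp [djj3.symm]) (by simp [dii3.symm]) hlneg hj3 hi3 hijpos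
    simpa [hB] using this

end Paper
end
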